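/- arXiv:math/0210375 — 7 statements merged into one kernel-verified Lean document; each statement's English description precedes it below -/
import Mathlib

section
/- Let m, n, r be positive integers with r ≤ m ≤ n. Let 1 ≤ a_1 < a_2 < … < a_r ≤ m and 1 ≤ b_1 < b_2 < … < b_r ≤ n be strictly increasing sequences of positive integers, and set P_i = (a_i, n) and Q_i = (m, b_i) for i = 1, …, r. Then the number of r-tuples of non-intersecting paths in X from P_1, …, P_r to Q_1, …, Q_r equals det[w(P_i, Q_j)]_{i,j=1,…,r}, where w(P_i, Q_j) is the number of paths in X from P_i to Q_j. -/
/-- A (lattice) path in `Y` from `P` to `Q`: a nonempty finite sequence of points of `Y`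
starting at `P`, ending at `Q`, each step either increases the first coordinate by 1 or
decreases the second coordinate by 1. -/
def LPath (Y : Set (ℤ × ℤ)) (P Q : ℤ × ℤ) (c : List (ℤ × ℤ)) : Prop :=
  c.head? = some P ∧ c.getLast? = some Q ∧ (∀ p ∈ c, p ∈ Y) ∧
  List.Chain' (fun p q : ℤ × ℤ => q = (p.1 + 1, p.2) ∨ q = (p.1, p.2 - 1)) c

/-- `w(P,Q)`: the number of paths in `Y` from `P` to `Q`. -/
noncomputable def pathCount (Y : Set (ℤ × ℤ)) (P Q : ℤ × ℤ) : ℕ :=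
  Nat.card {c : List (ℤ × ℤ) // LPath Y P Q c}

/-- The number of `r`-tuples of pairwise non-intersecting paths in `Y` from `P i` to `Q i`. -/
noncomputable def nipCount (Y : Set (ℤ × ℤ)) {r : ℕ} (P Q : Fin r → ℤ × ℤ) : ℕ :=
  Nat.card {C : Fin r → List (ℤ × ℤ) //
    (∀ i, LPath Y (P i) (Q i) (C i)) ∧
    ∀ i j, i ≠ j → ∀ p ∈ C i, p ∉ C j}

namespace ExitPath

/-- The points with `x ≤ m` and `1 ≤ y`, from which a path may continue. -/
def Inner (m : ℤ) (p : ℤ × ℤ) : Prop := p.1 ≤ m ∧ 1 ≤ p.2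

/-- A right or down step starting at an inner point. -/
def Step (m : ℤ) (p q : ℤ × ℤ) : Prop :=
  (q = (p.1 + 1, p.2) ∨ q = (p.1, p.2 - 1)) ∧ Inner m p

/-- The lattice paths from `P` to `Q` all of whose points but the last are inner. -/
def paths (m : ℤ) (P Q : ℤ × ℤ) : Set (List (ℤ × ℤ)) :=
  {c | c.head? = some P ∧ c.getLast? = some Q ∧ c.IsChain (Step m)}

/-- The tuples of pairwise disjoint paths from `P i` to `Q i`. -/
def tuples (m : ℤ) {r : ℕ} (P Q : Fin r → ℤ × ℤ) : Set (Fin r → List (ℤ × ℤ)) :=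
  {C | (∀ i, C i ∈ paths m (P i) (Q i)) ∧ ∀ i j, i ≠ j → ∀ p ∈ C i, p ∉ C j}

variable {m : ℤ} {P Q : ℤ × ℤ}

theorem cons_mem_paths {x : ℤ × ℤ} {c : List (ℤ × ℤ)} :
    x :: c ∈ paths m P Q ↔
      x = P ∧ ((c = [] ∧ P = Q) ∨ ∃ q, Step m P q ∧ c ∈ paths m q Q) := by
  cases c with
  | nil =>
    simp [paths]
    rintro rfl
    rfl
  | cons y l =>
    simp only [paths, Set.mem_ofPred_eq, List.head?_cons, List.getLast?_cons_cons,
      List.isChain_cons_cons, Option.some.injEq]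
    constructor
    · rintro ⟨rfl, h1, h2, h3⟩
      exact ⟨rfl, Or.inr ⟨y, h2, rfl, h1, h3⟩⟩
    · rintro ⟨rfl, ⟨h, -⟩ | ⟨q, h2, rfl, h1, h3⟩⟩
      · simp at h
      · exact ⟨rfl, h1, h2, h3⟩

theorem not_nil_mem_paths : [] ∉ paths m P Q := by simp [paths]

theorem paths_of_not_inner (hP : ¬ Inner m P) :
    paths m P Q = if P = Q then {[P]} else ∅ := by
  ext c
  cases c with
  | nil => by_cases h : P = Q <;> simp [not_nil_mem_paths, h]
  | cons x c =>
    rw [cons_mem_paths]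
    have : ¬ ∃ q, Step m P q ∧ c ∈ paths m q Q := fun ⟨q, h, _⟩ => hP h.2
    rw [or_iff_left this]
    by_cases h : P = Q <;> simp [h]

theorem paths_of_inner (hP : Inner m P) (hQ : ¬ Inner m Q) :
    paths m P Q =
      List.cons P '' (paths m (P.1 + 1, P.2) Q ∪ paths m (P.1, P.2 - 1) Q) := by
  ext c
  cases c with
  | nil => simp [not_nil_mem_paths]
  | cons x c =>
    rw [cons_mem_paths]
    have hne : P ≠ Q := by rintro rfl; exact hQ hP
    simp only [hne, and_false, false_or, Set.mem_image, Set.mem_union, List.cons.injEq]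
    constructor
    · rintro ⟨rfl, q, ⟨rfl | rfl, -⟩, h⟩
      · exact ⟨c, Or.inl h, rfl, rfl⟩
      · exact ⟨c, Or.inr h, rfl, rfl⟩
    · rintro ⟨c', h, rfl, rfl⟩
      rcases h with h | h
      · exact ⟨rfl, _, ⟨Or.inl rfl, hP⟩, h⟩
      · exact ⟨rfl, _, ⟨Or.inr rfl, hP⟩, h⟩

theorem disjoint_paths {P' Q' : ℤ × ℤ} (h : P ≠ P') :
    Disjoint (paths m P Q) (paths m P' Q') := by
  rw [Set.disjoint_left]
  rintro c ⟨h1, -⟩ ⟨h2, -⟩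
  exact h (by simpa [h1] using h2)

theorem head_mem {c : List (ℤ × ℤ)} (hc : c ∈ paths m P Q) : P ∈ c :=
  List.mem_of_head? hc.1

theorem eq_or_lt_of_mem {c : List (ℤ × ℤ)} (hc : c ∈ paths m P Q) {x : ℤ × ℤ} (hx : x ∈ c) :
    x = P ∨ (Inner m P ∧ P.1 ≤ x.1 ∧ x.2 ≤ P.2 ∧ P.1 - P.2 < x.1 - x.2) := by
  induction c generalizing P with
  | nil => simp at hx
  | cons y c ih =>
    obtain ⟨rfl, ⟨rfl, -⟩ | ⟨q, hq, hc'⟩⟩ := cons_mem_paths.1 hc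
    · left; simpa using hx
    rcases List.mem_cons.1 hx with rfl | hx
    · exact Or.inl rfl
    right
    refine ⟨hq.2, ?_⟩
    rcases ih hc' hx with rfl | ⟨-, h⟩ <;> rcases hq.1 with rfl | rfl <;> simp_all <;> omega

/-- An upper bound for the number of remaining steps of a path starting at `p`. -/
def height (m : ℤ) (p : ℤ × ℤ) : ℕ := (m + 1 - p.1).toNat + p.2.toNat

theorem height_right_lt (hP : Inner m P) : height m (P.1 + 1, P.2) < height m P := by
  have := hP.1
  simp only [height]
  omega

theorem height_down_lt (hP : Inner m P) : height m (P.1, P.2 - 1) < height m P := by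
  have := hP.2
  simp only [height]
  omega

theorem finite_paths (hQ : ¬ Inner m Q) (P : ℤ × ℤ) : (paths m P Q).Finite := by
  induction h : height m P using Nat.strong_induction_on generalizing P with
  | _ k ih =>
    subst h
    by_cases hP : Inner m P
    · rw [paths_of_inner hP hQ]
      exact ((ih _ (height_right_lt hP) _ rfl).union (ih _ (height_down_lt hP) _ rfl)).image _
    · rw [paths_of_not_inner hP]
      split_ifs <;> simp

theorem right_ne_down (P : ℤ × ℤ) : (P.1 + 1, P.2) ≠ (P.1, P.2 - 1) := by simp

theorem ncard_paths_of_inner (hP : Inner m P) (hQ : ¬ Inner m Q) :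
    (paths m P Q).ncard =
      (paths m (P.1 + 1, P.2) Q).ncard + (paths m (P.1, P.2 - 1) Q).ncard := by
  rw [paths_of_inner hP hQ, Set.ncard_image_of_injective _ List.cons_injective,
    Set.ncard_union_eq (disjoint_paths (right_ne_down P)) (finite_paths hQ _) (finite_paths hQ _)]

variable {r : ℕ} {p q : Fin r → ℤ × ℤ}

theorem finite_tuples (hq : ∀ j, ¬ Inner m (q j)) (p : Fin r → ℤ × ℤ) :
    (tuples m p q).Finite :=
  (Set.Finite.pi' fun i => finite_paths (hq i) (p i)).subset fun _ hC => hC.1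

theorem tuples_eq_empty (hp : ¬ Function.Injective p) : tuples m p q = ∅ := by
  rw [Set.eq_empty_iff_forall_notMem]
  rintro C ⟨h1, h2⟩
  simp only [Function.Injective, not_forall] at hp
  obtain ⟨i, j, hij, hne⟩ := hp
  exact h2 i j hne (p i) (head_mem (h1 i)) (hij ▸ head_mem (h1 j))

/-- Removing the first point of the path whose starting point comes first on the diagonals. -/
theorem tuples_of_inner (hp : Function.Injective p) (hq : ∀ j, ¬ Inner m (q j)) {i : Fin r}
    (hi : Inner m (p i))
    (hmin : ∀ k, Inner m (p k) → (p i).1 - (p i).2 ≤ (p k).1 - (p k).2) :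
    tuples m p q = (fun C => Function.update C i (p i :: C i)) ''
      (tuples m (Function.update p i ((p i).1 + 1, (p i).2)) q ∪
        tuples m (Function.update p i ((p i).1, (p i).2 - 1)) q) := by
  have key : ∀ k, k ≠ i → ∀ c ∈ paths m (p k) (q k), p i ∉ c := by
    intro k hk c hc hx
    rcases eq_or_lt_of_mem hc hx with h | ⟨h, -, -, h'⟩
    · exact hk (hp h.symm)
    · exact absurd (hmin k h) (by omega)
  apply Set.Subset.antisymm
  · rintro C ⟨h1, h2⟩
    have hCi := h1 i
    rw [paths_of_inner hi (hq i)] at hCi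
    obtain ⟨c, hc, hcC⟩ := hCi
    have hsub : ∀ s, c ∈ paths m s (q i) →
        Function.update C i c ∈ tuples m (Function.update p i s) q := by
      intro s hs
      have hmem : ∀ k, ∀ x ∈ Function.update C i c k, x ∈ C k := by
        intro k x hx
        by_cases hk : k = i
        · subst hk
          rw [← hcC]
          exact List.mem_cons_of_mem _ (by simpa using hx)
        · simpa [hk] using hx
      refine ⟨fun k => ?_, fun k l hkl x hx hx' => h2 k l hkl x (hmem k x hx) (hmem l x hx')⟩
      by_cases hk : k = i
      · subst hk; simpa using hs
      · simpa [hk] using h1 k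
    exact ⟨Function.update C i c, hc.imp (hsub _) (hsub _), by simp [hcC]⟩
  · have hsub : ∀ s, Step m (p i) s → ∀ C ∈ tuples m (Function.update p i s) q,
        Function.update C i (p i :: C i) ∈ tuples m p q := by
      rintro s hs C ⟨h1, h2⟩
      have h1' : ∀ k, k ≠ i → C k ∈ paths m (p k) (q k) := fun k hk => by simpa [hk] using h1 k
      refine ⟨fun k => ?_, fun k l hkl x hx hx' => ?_⟩
      · by_cases hk : k = i
        · subst hk
          rw [Function.update_self, cons_mem_paths]
          exact ⟨rfl, Or.inr ⟨s, hs, by simpa using h1 k⟩⟩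
        · simpa [hk] using h1' k hk
      · by_cases hk : k = i
        · subst hk
          rw [Function.update_self, List.mem_cons] at hx
          rw [Function.update_of_ne hkl.symm] at hx'
          rcases hx with rfl | hx
          · exact key l hkl.symm _ (h1' l hkl.symm) hx'
          · exact h2 k l hkl x hx hx'
        · rw [Function.update_of_ne hk] at hx
          by_cases hl : l = i
          · subst hl
            rw [Function.update_self, List.mem_cons] at hx'
            rcases hx' with rfl | hx'
            · exact key k hk _ (h1' k hk) hx
            · exact h2 k l hkl x hx hx'
          · rw [Function.update_of_ne hl] at hx'
            exact h2 k l hkl x hx hx'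
    rintro _ ⟨C, hC | hC, rfl⟩
    · exact hsub _ ⟨Or.inl rfl, hi⟩ C hC
    · exact hsub _ ⟨Or.inr rfl, hi⟩ C hC

theorem ncard_tuples_of_inner (hp : Function.Injective p) (hq : ∀ j, ¬ Inner m (q j)) {i : Fin r}
    (hi : Inner m (p i))
    (hmin : ∀ k, Inner m (p k) → (p i).1 - (p i).2 ≤ (p k).1 - (p k).2) :
    (tuples m p q).ncard =
      (tuples m (Function.update p i ((p i).1 + 1, (p i).2)) q).ncard +
        (tuples m (Function.update p i ((p i).1, (p i).2 - 1)) q).ncard := by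
  have hinj : Function.Injective
      (fun C : Fin r → List (ℤ × ℤ) => Function.update C i (p i :: C i)) := by
    intro C C' h
    funext k
    have hk := congrFun h k
    by_cases hki : k = i
    · subst hki; simpa using hk
    · simpa [hki] using hk
  rw [tuples_of_inner hp hq hi hmin, Set.ncard_image_of_injective _ hinj,
    Set.ncard_union_eq _ (finite_tuples hq _) (finite_tuples hq _)]
  rw [Set.disjoint_left]
  rintro C hC hC'
  have h1 := hC.1 i
  have h2 := hC'.1 i
  rw [Function.update_self] at h1 h2
  exact (Set.disjoint_left.1 (disjoint_paths (right_ne_down (p i)))) h1 h2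

/-- The matrix of the numbers of paths. -/
noncomputable def countMatrix (m : ℤ) (p q : Fin r → ℤ × ℤ) : Matrix (Fin r) (Fin r) ℤ :=
  Matrix.of fun i j => ((paths m (p i) (q j)).ncard : ℤ)

theorem countMatrix_update (i : Fin r) (s : ℤ × ℤ) :
    countMatrix m (Function.update p i s) q =
      (countMatrix m p q).updateRow i fun j => ((paths m s (q j)).ncard : ℤ) := by
  ext k j
  by_cases hk : k = i
  · subst hk; simp [countMatrix]
  · simp [countMatrix, hk]

theorem det_countMatrix_of_inner (hq : ∀ j, ¬ Inner m (q j)) {i : Fin r} (hi : Inner m (p i)) :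
    (countMatrix m p q).det =
      (countMatrix m (Function.update p i ((p i).1 + 1, (p i).2)) q).det +
        (countMatrix m (Function.update p i ((p i).1, (p i).2 - 1)) q).det := by
  rw [countMatrix_update, countMatrix_update, ← Matrix.det_updateRow_add]
  congr 1
  ext k j
  by_cases hk : k = i
  · subst hk
    simp [countMatrix, ncard_paths_of_inner hi (hq j)]
  · simp [hk]

theorem det_countMatrix_eq_zero (hp : ¬ Function.Injective p) : (countMatrix m p q).det = 0 := by
  simp only [Function.Injective, not_forall] at hp
  obtain ⟨i, j, hij, hne⟩ := hp
  refine Matrix.det_zero_of_row_eq hne ?_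
  funext k
  simp [countMatrix, hij]

theorem eq_of_forall_exists_eq (hp : Monotone p) (hpi : Function.Injective p)
    (hq : StrictMono q) (h : ∀ i, ∃ j, p i = q j) : p = q := by
  choose f hf using h
  have hfi : Function.Injective f := fun i j hij => hpi (by rw [hf, hf, hij])
  have hmono : StrictMono f := by
    refine Monotone.strictMono_of_injective (fun i j hij => ?_) hfi
    by_contra! hlt
    have := hp hij
    rw [hf, hf] at this
    exact (hq hlt).not_ge this
  have hfid : f = id := by
    rw [← StrictMono.range_inj hmono strictMono_id]
    simp [(Finite.injective_iff_surjective.1 hfi).range_eq]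
  funext i
  rw [hf i, hfid, id]

theorem ncard_tuples_of_not_inner (hp : Monotone p) (hpi : Function.Injective p)
    (hq : StrictMono q) (hin : ∀ i, ¬ Inner m (p i)) :
    ((tuples m p q).ncard : ℤ) = (countMatrix m p q).det := by
  by_cases h : ∀ i, ∃ j, p i = q j
  · obtain rfl := eq_of_forall_exists_eq hp hpi hq h
    have h1 : countMatrix m p p = 1 := by
      ext i j
      rw [countMatrix, Matrix.of_apply, paths_of_not_inner (hin i)]
      by_cases hij : i = j
      · subst hij; simp
      · simp [hij, hpi.ne hij]
    have h2 : tuples m p p = {fun i => [p i]} := by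
      ext C
      simp only [tuples, paths_of_not_inner (hin _), if_true, Set.mem_ofPred_eq,
        Set.mem_singleton_iff]
      constructor
      · exact fun hC => funext hC.1
      · rintro rfl
        exact ⟨fun _ => rfl, fun i j hij => by simpa using hpi.ne hij⟩
    simp [h1, h2]
  · push Not at h
    obtain ⟨i, hi⟩ := h
    rw [Matrix.det_eq_zero_of_row_eq_zero i
      (fun j => by simp [countMatrix, paths_of_not_inner (hin i), hi j])]
    have : tuples m p q = ∅ := by
      rw [Set.eq_empty_iff_forall_notMem]
      rintro C ⟨h1, -⟩
      have := h1 i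
      simp [paths_of_not_inner (hin i), hi i] at this
    simp [this]

theorem monotone_update (hp : Monotone p) (hpi : Function.Injective p) {i : Fin r}
    (hi : Inner m (p i))
    (hmin : ∀ k, Inner m (p k) → (p i).1 - (p i).2 ≤ (p k).1 - (p k).2) {s : ℤ × ℤ}
    (hs : Step m (p i) s) : Monotone (Function.update p i s) := by
  intro k l hkl
  rcases hkl.eq_or_lt with rfl | hlt
  · rfl
  have hle := hp hkl
  have hne : p k ≠ p l := hpi.ne hlt.ne
  rw [Ne, Prod.ext_iff] at hne
  obtain ⟨hs, -⟩ := hs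
  rw [Prod.le_def] at hle
  obtain ⟨hx, hy⟩ := hi
  by_cases hk : k = i
  · subst hk
    have := hmin l
    rw [Function.update_self, Function.update_of_ne hlt.ne', Prod.le_def]
    simp only [Inner] at this
    rcases hs with rfl | rfl <;> dsimp only <;> omega
  · rw [Function.update_of_ne hk]
    by_cases hl : l = i
    · subst hl
      have := hmin k
      rw [Function.update_self, Prod.le_def]
      simp only [Inner] at this
      rcases hs with rfl | rfl <;> dsimp only <;> omega
    · rwa [Function.update_of_ne hl]

theorem sum_height_update_lt {i : Fin r} {s : ℤ × ℤ} (h : height m s < height m (p i)) :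
    ∑ k, height m (Function.update p i s k) < ∑ k, height m (p k) := by
  refine Finset.sum_lt_sum (fun k _ => ?_) ⟨i, Finset.mem_univ i, by simpa using h⟩
  by_cases hk : k = i
  · subst hk; simpa using h.le
  · simp [hk]

theorem ncard_tuples_eq_det (hq : StrictMono q) (hq' : ∀ j, ¬ Inner m (q j)) (hp : Monotone p) :
    ((tuples m p q).ncard : ℤ) = (countMatrix m p q).det := by
  induction h : ∑ k, height m (p k) using Nat.strong_induction_on generalizing p with
  | _ N ih =>
    subst h
    by_cases hpi : Function.Injective p
    swap
    · simp [tuples_eq_empty hpi, det_countMatrix_eq_zero hpi]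
    by_cases hin : ∀ i, ¬ Inner m (p i)
    · exact ncard_tuples_of_not_inner hp hpi hq hin
    push Not at hin
    classical
    obtain ⟨i, hi, hmin⟩ := Finset.exists_min_image (Finset.univ.filter fun i => Inner m (p i))
      (fun i => (p i).1 - (p i).2) (by obtain ⟨i, hi⟩ := hin; exact ⟨i, by simpa using hi⟩)
    replace hi : Inner m (p i) := by simpa using hi
    replace hmin : ∀ k, Inner m (p k) → (p i).1 - (p i).2 ≤ (p k).1 - (p k).2 :=
      fun k hk => hmin k (by simpa using hk)
    rw [ncard_tuples_of_inner hpi hq' hi hmin, det_countMatrix_of_inner hq' hi, Nat.cast_add,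
      ih _ (sum_height_update_lt (height_right_lt hi))
        (monotone_update hp hpi hi hmin ⟨Or.inl rfl, hi⟩) rfl,
      ih _ (sum_height_update_lt (height_down_lt hi))
        (monotone_update hp hpi hi hmin ⟨Or.inr rfl, hi⟩) rfl]

theorem inner_of_isChain_append {c : List (ℤ × ℤ)} {z : ℤ × ℤ}
    (h : (c ++ [z]).IsChain (Step m)) {x : ℤ × ℤ} (hx : x ∈ c) : Inner m x := by
  induction c with
  | nil => simp at hx
  | cons y c ih =>
    rw [List.cons_append, List.isChain_cons] at h
    rcases List.mem_cons.1 hx with rfl | hx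
    · cases c with
      | nil => exact (h.1 z rfl).2
      | cons y' c => exact (h.1 y' rfl).2
    · exact ih h.2 hx

theorem lPath_iff {n a b : ℤ} (ha : 1 ≤ a) (hb : 1 ≤ b) {c : List (ℤ × ℤ)} :
    LPath {p | 1 ≤ p.1 ∧ p.1 ≤ m ∧ 1 ≤ p.2 ∧ p.2 ≤ n} (a, n) (m, b) c ↔
      c ++ [(m + 1, b)] ∈ paths m (a, n) (m + 1, b) ∧ c ≠ [] := by
  constructor
  · rintro ⟨h1, h2, h3, h4⟩
    have hne : c ≠ [] := by rintro rfl; simp at h1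
    refine ⟨⟨by simp [h1], by simp, ?_⟩, hne⟩
    rw [List.isChain_append]
    refine ⟨h4.imp_of_mem_imp fun x y hx _ hxy => ⟨hxy, (h3 x hx).2.1, (h3 x hx).2.2.1⟩,
      by simp, ?_⟩
    simp [h2, Step, Inner, hb]
  · rintro ⟨hc, hne⟩
    have hin : ∀ x ∈ c, Inner m x := fun x hx => inner_of_isChain_append hc.2.2 hx
    obtain ⟨h1, -, h3⟩ := id hc
    rw [List.isChain_append] at h3
    refine ⟨by rwa [List.head?_append_of_ne_nil _ hne] at h1, ?_, fun x hx => ?_,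
      h3.1.imp fun _ _ h => h.1⟩
    · have hlast := List.getLast?_eq_some_getLast hne
      have hmem := hin _ (List.getLast_mem hne)
      have hstep := h3.2.2 _ hlast (m + 1, b) rfl
      rw [hlast]
      generalize c.getLast hne = x at *
      obtain ⟨x1, x2⟩ := x
      simp only [Step, Inner, Prod.mk.injEq] at hstep hmem
      simp only [Option.some.injEq, Prod.mk.injEq]
      omega
    · have := hin x hx
      rcases eq_or_lt_of_mem hc (List.mem_append_left _ hx) with rfl | ⟨-, h5, h6, -⟩
      · exact ⟨ha, this.1, this.2, le_rfl⟩
      · exact ⟨ha.trans h5, this.1, this.2, h6⟩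

theorem exists_lPath_append {n a b : ℤ} (ha : 1 ≤ a) (ham : a ≤ m) (hb : 1 ≤ b)
    {c : List (ℤ × ℤ)} (hc : c ∈ paths m (a, n) (m + 1, b)) :
    ∃ c', LPath {p | 1 ≤ p.1 ∧ p.1 ≤ m ∧ 1 ≤ p.2 ∧ p.2 ≤ n} (a, n) (m, b) c' ∧
      c' ++ [(m + 1, b)] = c := by
  have h := List.dropLast_append_getLast? _ hc.2.1
  refine ⟨c.dropLast, (lPath_iff ha hb).2 ⟨by rwa [h], fun h0 => ?_⟩, h⟩
  rw [h0] at h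
  rw [← h] at hc
  have := hc.1
  simp at this
  omega

theorem pathCount_eq_ncard {n a b : ℤ} (ha : 1 ≤ a) (ham : a ≤ m) (hb : 1 ≤ b) :
    pathCount {p | 1 ≤ p.1 ∧ p.1 ≤ m ∧ 1 ≤ p.2 ∧ p.2 ≤ n} (a, n) (m, b) =
      (paths m (a, n) (m + 1, b)).ncard := by
  have h : paths m (a, n) (m + 1, b) = (· ++ [(m + 1, b)]) ''
      {c | LPath {p | 1 ≤ p.1 ∧ p.1 ≤ m ∧ 1 ≤ p.2 ∧ p.2 ≤ n} (a, n) (m, b) c} := by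
    ext c
    constructor
    · exact fun hc => exists_lPath_append ha ham hb hc
    · rintro ⟨c, hc, rfl⟩
      exact ((lPath_iff ha hb).1 hc).1
  rw [h, Set.ncard_image_of_injective _ (List.append_left_injective _)]
  exact Nat.card_coe_set_eq _

theorem nipCount_eq_ncard {n : ℤ} {a b : Fin r → ℤ} (ha : ∀ i, 1 ≤ a i) (ham : ∀ i, a i ≤ m)
    (hb : ∀ i, 1 ≤ b i) (hbi : Function.Injective b) :
    nipCount {p | 1 ≤ p.1 ∧ p.1 ≤ m ∧ 1 ≤ p.2 ∧ p.2 ≤ n} (fun i => (a i, n)) (fun i => (m, b i)) =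
      (tuples m (fun i => (a i, n)) (fun i => (m + 1, b i))).ncard := by
  have hinj : Function.Injective fun (C : Fin r → List (ℤ × ℤ)) i => C i ++ [(m + 1, b i)] :=
    fun C C' h => funext fun i => List.append_cancel_right (congrFun h i)
  have h : tuples m (fun i => (a i, n)) (fun i => (m + 1, b i)) =
      (fun (C : Fin r → List (ℤ × ℤ)) i => C i ++ [(m + 1, b i)]) ''
      {C | (∀ i, LPath {p | 1 ≤ p.1 ∧ p.1 ≤ m ∧ 1 ≤ p.2 ∧ p.2 ≤ n} (a i, n) (m, b i) (C i)) ∧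
        ∀ i j, i ≠ j → ∀ p ∈ C i, p ∉ C j} := by
    ext C
    constructor
    · rintro ⟨h1, h2⟩
      choose C' hC' hCC' using fun i => exists_lPath_append (ha i) (ham i) (hb i) (h1 i)
      refine ⟨C', ⟨hC', fun i j hij x hx hx' => h2 i j hij x ?_ ?_⟩, funext hCC'⟩
      · exact hCC' i ▸ List.mem_append_left _ hx
      · exact hCC' j ▸ List.mem_append_left _ hx'
    · rintro ⟨C, ⟨h1, h2⟩, rfl⟩
      refine ⟨fun i => ((lPath_iff (ha i) (hb i)).1 (h1 i)).1, fun i j hij x hx hx' => ?_⟩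
      have hout : ∀ k l, (m + 1, b k) ∉ C l := fun k l hkl => by
        have := ((h1 l).2.2.1 _ hkl).2.1
        simp at this
      simp only [List.mem_append, List.mem_singleton] at hx hx'
      rcases hx with hx | rfl
      · rcases hx' with hx' | rfl
        · exact h2 i j hij x hx hx'
        · exact hout j i hx
      · rcases hx' with hx' | hx'
        · exact hout i j hx'
        · exact hij (hbi (Prod.mk.inj hx').2)
  rw [h, Set.ncard_image_of_injective _ hinj]
  exact Nat.card_coe_set_eq _

end ExitPath

theorem stmt0 (m n r : ℕ) (hr : 0 < r) (hrm : r ≤ m) (hmn : m ≤ n)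
    (a b : Fin r → ℤ)
    (ha : StrictMono a) (ha1 : ∀ i, 1 ≤ a i) (ham : ∀ i, a i ≤ (m : ℤ))
    (hb : StrictMono b) (hb1 : ∀ i, 1 ≤ b i) (hbn : ∀ i, b i ≤ (n : ℤ))
    (X : Set (ℤ × ℤ))
    (hX : X = {p : ℤ × ℤ | 1 ≤ p.1 ∧ p.1 ≤ (m : ℤ) ∧ 1 ≤ p.2 ∧ p.2 ≤ (n : ℤ)}) :
    (nipCount X (fun i => (a i, (n : ℤ))) (fun i => ((m : ℤ), b i)) : ℤ) =
      Matrix.det (Matrix.of fun i j : Fin r =>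
        (pathCount X (a i, (n : ℤ)) ((m : ℤ), b j) : ℤ)) := by
  subst hX
  rw [ExitPath.nipCount_eq_ncard ha1 ham hb1 hb.injective, ExitPath.ncard_tuples_eq_det]
  · congr 1
    ext i j
    simp [ExitPath.countMatrix, ExitPath.pathCount_eq_ncard (ha1 i) (ham i) (hb1 j)]
  · exact fun i j hij => Prod.mk_lt_mk_iff_right.2 (hb hij)
  · simp [ExitPath.Inner]
  · exact fun i j hij => Prod.mk_le_mk_iff_left.2 (ha.monotone hij)
end

section
/- Let m, n, r be positive integers with r ≤ m ≤ n. Let 1 ≤ a_1 < a_2 < … < a_r ≤ m and 1 ≤ b_1 < b_2 < … < b_r ≤ n be strictly increasing sequences of positive integers, and set P_i = (a_i, n) and Q_i = (m, b_i) for i = 1, …, r. Then the number of r-tuples of non-intersecting paths in X from P_1, …, P_r to Q_1, …, Q_r equals det[C(m+n−a_i−b_j, m−a_i)]_{i,j=1,…,r}. (This determinant is the multiplicity of the mixed determinantal ring of Herzog and Trung.) -/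
/-- The binomial coefficient `C(N, x)` for integers, with the convention that it is `0`
when `N < 0`, `x < 0`, or `x > N`. -/
def ibinom (N x : ℤ) : ℤ :=
  if 0 ≤ N ∧ 0 ≤ x then (N.toNat.choose x.toNat : ℤ) else 0

/-- The index set `T = {(a,b) : a − b = 0 or a − b = 1}`. -/
def Tset : Set (ℤ × ℤ) := {p : ℤ × ℤ | p.1 - p.2 = 0 ∨ p.1 - p.2 = 1}

section Splice

variable {α : Type*} [DecidableEq α]

/-- Follow `c` up to the first visit of `p`, then follow `d` from its first visit of `p` on. -/
def splice (p : α) (c d : List α) : List α :=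
  c.takeWhile (· ≠ p) ++ d.dropWhile (· ≠ p)

theorem splice_self (p : α) (c : List α) : splice p c c = c :=
  List.takeWhile_append_dropWhile

theorem takeWhile_splice (p : α) (c d : List α) :
    (splice p c d).takeWhile (· ≠ p) = c.takeWhile (· ≠ p) := by
  unfold splice
  rw [List.takeWhile_append_of_pos fun _ => List.mem_takeWhile_imp]
  induction d with
  | nil => simp
  | cons x d ih => by_cases h : x = p <;> simp_all

theorem dropWhile_splice (p : α) (c d : List α) :
    (splice p c d).dropWhile (· ≠ p) = d.dropWhile (· ≠ p) := by
  unfold splice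
  rw [List.dropWhile_append_of_pos fun _ => List.mem_takeWhile_imp]
  exact List.dropWhile_idempotent _ d

theorem mem_splice_self_iff (p : α) (c d : List α) : p ∈ splice p c d ↔ p ∈ d := by
  have hc : p ∉ c.takeWhile (· ≠ p) := fun h => by simpa using List.mem_takeWhile_imp h
  have hd : p ∉ d.takeWhile (· ≠ p) := fun h => by simpa using List.mem_takeWhile_imp h
  conv_rhs => rw [← splice_self p d]
  simp only [splice, List.mem_append, hc, hd, false_or]

theorem exists_splice_eq {p : α} {c d : List α} (hc : p ∈ c) (hd : p ∈ d) :
    ∃ c₁ c₂ d₁ d₂, c = c₁ ++ p :: c₂ ∧ d = d₁ ++ p :: d₂ ∧ splice p c d = c₁ ++ p :: d₂ := by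
  have key : ∀ e : List α, p ∈ e → ∃ e₂, e.dropWhile (· ≠ p) = p :: e₂ := by
    intro e he
    induction e with
    | nil => simp at he
    | cons x e ih => by_cases h : x = p <;> grind [List.dropWhile_cons]
  obtain ⟨c₂, h₁⟩ := key c hc
  obtain ⟨d₂, h₂⟩ := key d hd
  exact ⟨_, c₂, _, d₂, by rw [← h₁, List.takeWhile_append_dropWhile],
    by rw [← h₂, List.takeWhile_append_dropWhile], by rw [splice, h₂]⟩

end Splice

section LindstromGesselViennot

open Finset

variable {α ι : Type*} [DecidableEq α]

section Multiplicity

variable [Fintype ι]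

/-- The number of visits of the family `C` to each point. -/
def visits (C : ι → List α) (x : α) : ℕ := ∑ i, (C i).count x

theorem two_le_visits_iff {C : ι → List α} (hC : ∀ i, (C i).Nodup) (x : α) :
    2 ≤ visits C x ↔ ∃ i j, i ≠ j ∧ x ∈ C i ∧ x ∈ C j := by
  have h : visits C x = #{i | x ∈ C i} := by
    rw [visits, Finset.card_filter]
    exact sum_congr rfl fun i _ => (hC i).count
  rw [h, ← Nat.lt_iff_add_one_le, one_lt_card]
  simp only [mem_filter, mem_univ, true_and]
  grind

/-- A point of multiplicity at least two, chosen only in terms of the multiplicities. -/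
noncomputable def crossing [Nonempty α] (C : ι → List α) : α :=
  Classical.epsilon fun x => 2 ≤ visits C x

/-- Two members of the family passing through `x`, chosen only in terms of the set of all
members passing through `x`. -/
noncomputable def crossingPair [Nonempty ι] (C : ι → List α) (x : α) : ι × ι :=
  Classical.epsilon fun ij => ij.1 ≠ ij.2 ∧ x ∈ C ij.1 ∧ x ∈ C ij.2

/-- Exchange the tails after `p` of the members of the family according to `τ`. -/
def exchange (p : α) (τ : Equiv.Perm ι) (C : ι → List α) (k : ι) : List α :=
  splice p (C k) (C (τ k))

theorem visits_exchange (p : α) (τ : Equiv.Perm ι) (C : ι → List α) :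
    visits (exchange p τ C) = visits C := by
  funext x
  have h : visits C x = ∑ k, ((C k).takeWhile (· ≠ p)).count x
      + ∑ k, ((C k).dropWhile (· ≠ p)).count x := by
    rw [visits, ← sum_add_distrib]
    refine sum_congr rfl fun k _ => ?_
    rw [← List.count_append, List.takeWhile_append_dropWhile]
  rw [h, ← Equiv.sum_comp τ fun k => ((C k).dropWhile (· ≠ p)).count x, ← sum_add_distrib]
  exact sum_congr rfl fun k _ => List.count_append

theorem crossing_spec [Nonempty α] [Nonempty ι] {C : ι → List α} (hC : ∀ i, (C i).Nodup)
    (h : ∃ i j, i ≠ j ∧ ∃ x, x ∈ C i ∧ x ∈ C j) :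
    (crossingPair C (crossing C)).1 ≠ (crossingPair C (crossing C)).2 ∧
      crossing C ∈ C (crossingPair C (crossing C)).1 ∧
      crossing C ∈ C (crossingPair C (crossing C)).2 := by
  obtain ⟨i, j, hij, x, hi, hj⟩ := h
  have hx : 2 ≤ visits C (crossing C) := Classical.epsilon_spec (p := fun x => 2 ≤ visits C x)
    ⟨x, (two_le_visits_iff hC x).2 ⟨i, j, hij, hi, hj⟩⟩
  obtain ⟨i, j, h⟩ := (two_le_visits_iff hC _).1 hx
  exact Classical.epsilon_spec
    (p := fun ij : ι × ι => ij.1 ≠ ij.2 ∧ crossing C ∈ C ij.1 ∧ crossing C ∈ C ij.2) ⟨(i, j), h⟩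

end Multiplicity

section Swap

variable [DecidableEq ι]

theorem exchange_exchange (p : α) (i j : ι) (C : ι → List α) :
    exchange p (Equiv.swap i j) (exchange p (Equiv.swap i j) C) = C := by
  funext k
  simp only [exchange]
  conv_lhs => rw [splice, takeWhile_splice, dropWhile_splice, Equiv.swap_apply_self,
    List.takeWhile_append_dropWhile]

theorem mem_exchange_iff {p : α} {i j : ι} {C : ι → List α} (hi : p ∈ C i) (hj : p ∈ C j)
    (k : ι) : p ∈ exchange p (Equiv.swap i j) C k ↔ p ∈ C k := by
  rw [exchange, mem_splice_self_iff]
  by_cases h₁ : k = i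
  · subst h₁; simp [hi, hj]
  by_cases h₂ : k = j
  · subst h₂; simp [hi, hj]
  rw [Equiv.swap_apply_of_ne_of_ne h₁ h₂]

end Swap

variable [Fintype ι] [DecidableEq ι]

/-- The **Lindström–Gessel–Viennot lemma**, for families of repetition-free lists closed under
splicing. -/
theorem det_card_eq_sum_sign (W : ι → ι → Finset (List α))
    (hnodup : ∀ i j, ∀ c ∈ W i j, c.Nodup)
    (hsplice : ∀ i j k l, ∀ c ∈ W i j, ∀ d ∈ W k l, ∀ p ∈ c, p ∈ d → splice p c d ∈ W i l) :
    Matrix.det (Matrix.of fun i j => (#(W i j) : ℤ)) =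
      ∑ x ∈ (univ.sigma fun σ : Equiv.Perm ι => Fintype.piFinset fun i => W i (σ i)) with
        ∀ i j, i ≠ j → ∀ p ∈ x.2 i, p ∉ x.2 j, (Equiv.Perm.sign x.1 : ℤ) := by
  classical
  set S := univ.sigma fun σ : Equiv.Perm ι => Fintype.piFinset fun i => W i (σ i) with hS
  have hdet : Matrix.det (Matrix.of fun i j => (#(W i j) : ℤ)) =
      ∑ x ∈ S, (Equiv.Perm.sign x.1 : ℤ) := by
    rw [← Matrix.det_transpose, Matrix.det_apply', hS, sum_sigma]
    refine sum_congr rfl fun σ _ => ?_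
    simp [mul_comm]
  rw [hdet, ← sum_filter_add_sum_filter_not S
    fun x => ∀ i j, i ≠ j → ∀ p ∈ x.2 i, p ∉ x.2 j, add_eq_left]
  rcases isEmpty_or_nonempty ι with hι | hι
  · refine sum_eq_zero fun x hx => absurd (fun i => isEmptyElim i) (mem_filter.1 hx).2
  rcases isEmpty_or_nonempty α with hα | hα
  · refine sum_eq_zero fun x hx => absurd (fun _ _ _ p => isEmptyElim p) (mem_filter.1 hx).2
  let pt (x : Σ _ : Equiv.Perm ι, ι → List α) := crossing x.2
  let tr (x : Σ _ : Equiv.Perm ι, ι → List α) : Equiv.Perm ι :=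
    Equiv.swap (crossingPair x.2 (pt x)).1 (crossingPair x.2 (pt x)).2
  let g (x : Σ _ : Equiv.Perm ι, ι → List α) : Σ _ : Equiv.Perm ι, ι → List α :=
    ⟨x.1 * tr x, exchange (pt x) (tr x) x.2⟩
  have hspec : ∀ x ∈ S.filter (fun x => ¬ ∀ i j, i ≠ j → ∀ p ∈ x.2 i, p ∉ x.2 j),
      (∀ i, x.2 i ∈ W i (x.1 i)) ∧
      (crossingPair x.2 (pt x)).1 ≠ (crossingPair x.2 (pt x)).2 ∧
      pt x ∈ x.2 (crossingPair x.2 (pt x)).1 ∧ pt x ∈ x.2 (crossingPair x.2 (pt x)).2 := by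
    intro x hx
    obtain ⟨hxS, hx⟩ := mem_filter.1 hx
    have hxW : ∀ i, x.2 i ∈ W i (x.1 i) := by simpa [hS] using hxS
    push Not at hx
    exact ⟨hxW, crossing_spec (fun i => hnodup _ _ _ (hxW i)) hx⟩
  refine sum_involution (fun x _ => g x) ?_ ?_ ?_ ?_
  · intro x hx
    obtain ⟨_, hne, _⟩ := hspec x hx
    simp [g, tr, Equiv.Perm.sign_swap hne]
  · intro x hx _ heq
    obtain ⟨_, hne, _⟩ := hspec x hx
    have h : x.1 * tr x = x.1 := congrArg Sigma.fst heq
    rw [mul_eq_left, Equiv.swap_eq_one_iff] at h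
    exact hne h
  · intro x hx
    obtain ⟨hW, hne, hi, hj⟩ := hspec x hx
    refine mem_filter.2 ⟨?_, ?_⟩
    · simp only [hS, mem_sigma, mem_univ, true_and, Fintype.mem_piFinset]
      intro k
      change splice _ _ _ ∈ W k (x.1 (tr x k))
      by_cases h₁ : k = (crossingPair x.2 (pt x)).1
      · refine hsplice _ _ _ _ _ (hW k) _ (hW _) _ (h₁ ▸ hi) ?_
        simpa [h₁, tr] using hj
      by_cases h₂ : k = (crossingPair x.2 (pt x)).2
      · refine hsplice _ _ _ _ _ (hW k) _ (hW _) _ (h₂ ▸ hj) ?_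
        simpa [h₂, tr] using hi
      · rw [show tr x k = k from Equiv.swap_apply_of_ne_of_ne h₁ h₂, splice_self]
        exact hW k
    · intro h
      exact h _ _ hne (pt x) ((mem_exchange_iff hi hj _).2 hi) ((mem_exchange_iff hi hj _).2 hj)
  · intro x hx
    obtain ⟨hW, hne, hi, hj⟩ := hspec x hx
    have hpt : pt (g x) = pt x := by
      simp only [pt, g, crossing, visits_exchange]
    have hpair : crossingPair (g x).2 (pt x) = crossingPair x.2 (pt x) := by
      unfold crossingPair
      congr 1
      funext ij
      simp only [g, tr, mem_exchange_iff hi hj]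
    have htr : tr (g x) = tr x := by simp only [tr, hpt, hpair]
    refine Sigma.ext ?_ (heq_of_eq ?_)
    · change x.1 * tr x * tr (g x) = x.1
      rw [htr, mul_assoc, Equiv.swap_mul_self, mul_one]
    · change exchange (pt (g x)) (tr (g x)) (exchange (pt x) (tr x) x.2) = x.2
      rw [htr, hpt]
      exact exchange_exchange _ _ _ _

end LindstromGesselViennot

section LatticePaths

variable {Y : Set (ℤ × ℤ)} {p q : ℤ × ℤ} {c d : List (ℤ × ℤ)}

theorem lPath_iff : LPath Y p q c ↔ c.head? = some p ∧ c.getLast? = some q ∧ (∀ x ∈ c, x ∈ Y) ∧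
    c.IsChain fun x y => y = (x.1 + 1, x.2) ∨ y = (x.1, x.2 - 1) :=
  Iff.rfl

theorem not_lPath_nil : ¬ LPath Y p q [] := by
  simp [LPath]

theorem lPath_cons_iff {x : ℤ × ℤ} : LPath Y p q (x :: c) ↔ x = p ∧ p ∈ Y ∧
    (c = [] ∧ p = q ∨ LPath Y (p.1 + 1, p.2) q c ∨ LPath Y (p.1, p.2 - 1) q c) := by
  cases c with
  | nil => simp [lPath_iff]; grind
  | cons y c =>
    simp only [lPath_iff, List.isChain_cons_cons, List.head?_cons, Option.some.injEq,
      List.getLast?_cons_cons, List.mem_cons, forall_eq_or_imp, reduceCtorEq, false_and,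
      false_or]
    grind

/-- Every point of a path lies in the rectangle spanned by its endpoints. -/
theorem LPath.bounds (h : LPath Y p q c) :
    ∀ x ∈ c, p.1 ≤ x.1 ∧ x.1 ≤ q.1 ∧ q.2 ≤ x.2 ∧ x.2 ≤ p.2 := by
  induction c generalizing p with
  | nil => simp
  | cons y c ih =>
    obtain ⟨rfl, -, ⟨rfl, rfl⟩ | h | h⟩ := lPath_cons_iff.1 h
    · simp
    all_goals
      have hc := ih h
      have hne : ∃ z, z ∈ c := List.exists_mem_of_ne_nil c (by rintro rfl; exact not_lPath_nil h)
      obtain ⟨z, hz⟩ := hne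
      have := hc z hz
      intro x hx
      rcases List.mem_cons.1 hx with rfl | hx
      · dsimp only at this; omega
      · have := hc x hx
        dsimp only at this; omega

theorem LPath.le (h : LPath Y p q c) : p.1 ≤ q.1 ∧ q.2 ≤ p.2 := by
  have := h.bounds p (List.mem_of_head? h.1)
  omega

theorem LPath.nodup (h : LPath Y p q c) : c.Nodup := by
  induction c generalizing p with
  | nil => simp
  | cons y c ih =>
    obtain ⟨rfl, -, ⟨rfl, rfl⟩ | h | h⟩ := lPath_cons_iff.1 h
    · simp
    all_goals
      refine List.nodup_cons.2 ⟨fun hy => ?_, ih h⟩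
      have := h.bounds y hy
      dsimp only at this; omega

theorem lPath_append_cons_iff {x : ℤ × ℤ} : LPath Y p q (c ++ x :: d) ↔
    LPath Y p x (c ++ [x]) ∧ LPath Y x q (x :: d) := by
  simp only [lPath_iff]
  rw [List.isChain_split]
  have h₁ : (c ++ x :: d).head? = (c ++ [x]).head? := by cases c <;> rfl
  have h₂ : (c ++ x :: d).getLast? = (x :: d).getLast? := by
    rw [List.getLast?_append, List.getLast?_cons, Option.some_or]
  rw [h₁, h₂]
  simp only [List.mem_append, List.mem_cons, List.getLast?_concat, List.head?_cons,
    List.not_mem_nil]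
  grind

theorem LPath.splice {p' q' x : ℤ × ℤ} (hc : LPath Y p q c) (hd : LPath Y p' q' d)
    (hxc : x ∈ c) (hxd : x ∈ d) : LPath Y p q' (splice x c d) := by
  obtain ⟨c₁, c₂, d₁, d₂, rfl, rfl, h⟩ := exists_splice_eq hxc hxd
  rw [h]
  exact lPath_append_cons_iff.2 ⟨(lPath_append_cons_iff.1 hc).1, (lPath_append_cons_iff.1 hd).2⟩

/-- Measure the time of a point by `x.1 - x.2`, so that each step takes one unit. A path that starts
weakly earlier and lower than another one, and ends weakly earlier but weakly to its right, meets
it if they overlap in time. -/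
theorem LPath.exists_mem_mem {p' q' : ℤ × ℤ} (hc : LPath Y p q c) (hd : LPath Y p' q' d)
    (hstart : p.1 - p.2 ≤ p'.1 - p'.2) (htop : p.2 ≤ p'.2)
    (hover : p'.1 - p'.2 ≤ q.1 - q.2) (hend : q.1 - q.2 ≤ q'.1 - q'.2) (hright : q'.1 ≤ q.1) :
    ∃ x, x ∈ c ∧ x ∈ d := by
  induction c generalizing p p' d with
  | nil => exact absurd hc not_lPath_nil
  | cons y c ih =>
    have hc' := hc
    have hd' := hd
    obtain ⟨rfl, -, hc⟩ := lPath_cons_iff.1 hc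
    rcases hstart.lt_or_eq with hlt | heq
    · rcases hc with ⟨rfl, rfl⟩ | hc | hc
      · omega
      all_goals
        obtain ⟨x, hx, hx'⟩ := ih hc hd' (by dsimp only; omega) (by dsimp only; omega) hover
        exact ⟨x, List.mem_cons_of_mem _ hx, hx'⟩
    · by_cases hyp : y = p'
      · exact ⟨y, List.mem_cons_self, hyp ▸ List.mem_of_head? hd.1⟩
      have hlt : y.1 < p'.1 := by
        by_contra hge
        exact hyp (Prod.ext (by omega) (by omega))
      cases d with
      | nil => exact absurd hd not_lPath_nil
      | cons z d =>
        obtain ⟨rfl, -, hd⟩ := lPath_cons_iff.1 hd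
        have := hd'.le
        rcases hc with ⟨rfl, rfl⟩ | hc | hc
        · omega
        all_goals
          have := hc.le
          rcases hd with ⟨rfl, rfl⟩ | hd | hd
          · dsimp only at *; omega
          all_goals
            obtain ⟨x, hx, hx'⟩ := ih hc hd (by dsimp only; omega) (by dsimp only; omega)
              (by dsimp only; omega)
            exact ⟨x, List.mem_cons_of_mem _ hx, List.mem_cons_of_mem _ hx'⟩

/-- The unrestricted lattice paths with `N` steps from `p` to `q`. -/
def latticePaths : ℕ → ℤ × ℤ → ℤ × ℤ → Finset (List (ℤ × ℤ))
  | 0, p, q => if p = q then {[p]} else ∅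
  | N + 1, p, q => (latticePaths N (p.1 + 1, p.2) q ∪ latticePaths N (p.1, p.2 - 1) q).map
      ⟨List.cons p, List.cons_injective⟩

theorem mem_latticePaths {N : ℕ} (hN : q.1 - p.1 + (p.2 - q.2) = N) :
    c ∈ latticePaths N p q ↔ LPath Set.univ p q c := by
  induction N generalizing p c with
  | zero =>
    cases c with
    | nil => simp [latticePaths, not_lPath_nil]; split_ifs <;> simp
    | cons y c =>
      have h₁ : ¬ LPath Set.univ (p.1 + 1, p.2) q c := fun h => by
        have := h.le; dsimp only at this; omega
      have h₂ : ¬ LPath Set.univ (p.1, p.2 - 1) q c := fun h => by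
        have := h.le; dsimp only at this; omega
      rw [lPath_cons_iff]
      simp only [latticePaths, h₁, h₂]
      split_ifs with h <;> simp [h]
  | succ N ih =>
    cases c with
    | nil => simp [latticePaths, not_lPath_nil]
    | cons y c =>
      have hne : p ≠ q := by rintro rfl; omega
      simp only [latticePaths, Finset.mem_map, Finset.mem_union, Function.Embedding.coeFn_mk]
      rw [lPath_cons_iff, ← ih (by dsimp only; omega), ← ih (by dsimp only; omega)]
      grind

theorem card_latticePaths {N : ℕ} (hN : q.1 - p.1 + (p.2 - q.2) = N) :
    ((latticePaths N p q).card : ℤ) = ibinom N (q.1 - p.1) := by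
  induction N generalizing p with
  | zero =>
    rw [latticePaths]
    obtain ⟨k, hk⟩ : ∃ k, k = q.1 - p.1 := ⟨_, rfl⟩
    rw [← hk, ibinom]
    split_ifs with h₁ h₂ h₂
    · subst h₁; simp [hk]
    · subst h₁; omega
    · have : k.toNat ≠ 0 := fun h => h₁ (Prod.ext (by omega) (by omega))
      obtain ⟨l, hl⟩ := Nat.exists_eq_succ_of_ne_zero this
      simp [hl]
    · simp
  | succ N ih =>
    have h₁ : q.1 - (p.1 + 1) + (p.2 - q.2) = N := by omega
    have h₂ : q.1 - p.1 + (p.2 - 1 - q.2) = N := by omega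
    have hdisj : Disjoint (latticePaths N (p.1 + 1, p.2) q) (latticePaths N (p.1, p.2 - 1) q) := by
      refine Finset.disjoint_left.2 fun c hc hc' => ?_
      have e₁ := ((mem_latticePaths h₁).1 hc).1
      have e₂ := ((mem_latticePaths h₂).1 hc').1
      simp [e₁] at e₂
    rw [latticePaths, Finset.card_map, Finset.card_union_of_disjoint hdisj, Nat.cast_add,
      ih h₁, ih h₂]
    dsimp only
    obtain ⟨k, hk⟩ : ∃ k, k = q.1 - p.1 := ⟨_, rfl⟩
    rw [← sub_sub, ← hk]
    unfold ibinom
    rcases lt_trichotomy k 0 with h | rfl | h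
    · simp [h.not_ge, show ¬ (1 ≤ k) by omega]
    · simp; omega
    · obtain ⟨l, rfl⟩ : ∃ l : ℕ, k = l + 1 := ⟨(k - 1).toNat, by omega⟩
      rw [if_pos (by omega), if_pos (by omega), if_pos (by omega)]
      rw [show (l + 1 - 1 : ℤ).toNat = l by omega, show (l + 1 : ℤ).toNat = l + 1 by omega]
      rw [Int.toNat_natCast, Int.toNat_natCast, Nat.choose_succ_succ, Nat.cast_add]

end LatticePaths

theorem lPath_rectangle_iff {m n : ℤ} {p q : ℤ × ℤ} (hp : 1 ≤ p.1 ∧ p.2 ≤ n)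
    (hq : q.1 ≤ m ∧ 1 ≤ q.2) {c : List (ℤ × ℤ)} :
    LPath {p : ℤ × ℤ | 1 ≤ p.1 ∧ p.1 ≤ m ∧ 1 ≤ p.2 ∧ p.2 ≤ n} p q c ↔
      LPath Set.univ p q c := by
  refine ⟨fun h => ⟨h.1, h.2.1, fun _ _ => trivial, h.2.2.2⟩,
    fun h => ⟨h.1, h.2.1, fun x hx => ?_, h.2.2.2⟩⟩
  have := h.bounds x hx
  simp only [Set.mem_ofPred_eq]
  omega

theorem stmt1 (m n r : ℕ) (hr : 0 < r) (hrm : r ≤ m) (hmn : m ≤ n)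
    (a b : Fin r → ℤ)
    (ha : StrictMono a) (ha1 : ∀ i, 1 ≤ a i) (ham : ∀ i, a i ≤ (m : ℤ))
    (hb : StrictMono b) (hb1 : ∀ i, 1 ≤ b i) (hbn : ∀ i, b i ≤ (n : ℤ))
    (X : Set (ℤ × ℤ))
    (hX : X = {p : ℤ × ℤ | 1 ≤ p.1 ∧ p.1 ≤ (m : ℤ) ∧ 1 ≤ p.2 ∧ p.2 ≤ (n : ℤ)}) :
    (nipCount X (fun i => (a i, (n : ℤ))) (fun i => ((m : ℤ), b i)) : ℤ) =
      Matrix.det (Matrix.of fun i j : Fin r =>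
        ibinom ((m : ℤ) + n - a i - b j) ((m : ℤ) - a i)) := by
  classical
  let P : Fin r → ℤ × ℤ := fun i => (a i, n)
  let Q : Fin r → ℤ × ℤ := fun i => (m, b i)
  let W : Fin r → Fin r → Finset (List (ℤ × ℤ)) := fun i j =>
    latticePaths ((m : ℤ) + n - a i - b j).toNat (P i) (Q j)
  have hN : ∀ i j, (Q j).1 - (P i).1 + ((P i).2 - (Q j).2) =
      (((m : ℤ) + n - a i - b j).toNat : ℤ) := by
    intro i j
    have := ham i
    have := hbn j
    simp only [P, Q]
    omega
  have hW : ∀ i j c, c ∈ W i j ↔ LPath X (P i) (Q j) c := by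
    intro i j c
    rw [hX, lPath_rectangle_iff (p := P i) (q := Q j) ⟨ha1 i, le_rfl⟩ ⟨le_rfl, hb1 j⟩]
    exact mem_latticePaths (hN i j)
  have hcard : ∀ i j, ibinom ((m : ℤ) + n - a i - b j) ((m : ℤ) - a i) = ((W i j).card : ℤ) := by
    intro i j
    have := ham i
    have := hbn j
    rw [card_latticePaths (hN i j), Int.toNat_of_nonneg (by omega)]
  have hone : ∀ (σ : Equiv.Perm (Fin r)) (C : Fin r → List (ℤ × ℤ)), (∀ i, C i ∈ W i (σ i)) →
      (∀ i j, i ≠ j → ∀ p ∈ C i, p ∉ C j) → σ = 1 := by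
    intro σ C hC hdisj
    have hσ : StrictMono σ := by
      intro i j hij
      by_contra hle
      have hlt : σ j < σ i := lt_of_le_of_ne (not_lt.1 hle) fun h => hij.ne' (σ.injective h)
      have := ha hij
      have := hb hlt
      have := ham j
      have := hbn (σ i)
      obtain ⟨x, hx, hx'⟩ := ((hW _ _ _).1 (hC i)).exists_mem_mem ((hW _ _ _).1 (hC j))
        (by simp only [P]; omega) le_rfl (by simp only [P, Q]; omega)
        (by simp only [Q]; omega) le_rfl
      exact hdisj i j hij.ne x hx hx'
    exact DFunLike.coe_injective <| (hσ.range_inj strictMono_id).1 <| by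
      rw [σ.surjective.range_eq, Set.range_id]
  simp only [hcard]
  rw [det_card_eq_sum_sign W (fun i j c hc => ((hW i j c).1 hc).nodup)
    fun i j k l c hc d hd p hpc hpd =>
      (hW _ _ _).2 (((hW _ _ _).1 hc).splice ((hW _ _ _).1 hd) hpc hpd)]
  rw [nipCount, Nat.subtype_card ((Fintype.piFinset fun i => W i i).filter
    fun C => ∀ i j, i ≠ j → ∀ p ∈ C i, p ∉ C j) (by simp [hW, P, Q])]
  rw [Finset.cast_card]
  refine Finset.sum_bij' (fun C _ => ⟨1, C⟩) (fun x _ => x.2) ?_ ?_ ?_ ?_ ?_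
  · intro C hC
    simpa using hC
  · rintro ⟨σ, C⟩ hx
    simp only [Finset.mem_filter, Finset.mem_sigma, Finset.mem_univ, true_and,
      Fintype.mem_piFinset] at hx ⊢
    obtain rfl := hone σ C hx.1 hx.2
    exact hx
  · intro C _
    rfl
  · rintro ⟨σ, C⟩ hx
    simp only [Finset.mem_filter, Finset.mem_sigma, Finset.mem_univ, true_and,
      Fintype.mem_piFinset] at hx
    rw [hone σ C hx.1 hx.2]
  · intro C _
    simp
end

section
/- Let 0 ≤ a_1 < a_2 < … < a_k and 0 ≤ b_1 < b_2 < … < b_k be strictly increasing sequences of non-negative integers, and set A_i = (0, a_i) and B_i = (b_i, b_i) for i = 1, …, k. Then the number of k-tuples of non-intersecting paths in W = {(i,j) ∈ ℤ×ℤ : 0 ≤ i ≤ j} from A_1, …, A_k to B_1, …, B_k equals det[C(a_i, b_j)]_{i,j=1,…,k}. -/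
theorem lPath_snoc_iff {Y : Set (ℤ × ℤ)} {P Q R : ℤ × ℤ} {c : List (ℤ × ℤ)} :
    LPath Y P Q (c ++ [R]) ↔ R = Q ∧ Q ∈ Y ∧ ((c = [] ∧ P = Q) ∨
      ∃ Q', LPath Y P Q' c ∧ (Q = (Q'.1 + 1, Q'.2) ∨ Q = (Q'.1, Q'.2 - 1))) := by
  rcases List.eq_nil_or_concat c with rfl | ⟨c, x, rfl⟩
  · simp only [LPath, List.nil_append, List.head?_cons, Option.some.injEq, List.getLast?_singleton,
      List.mem_singleton, forall_eq, List.head?_nil]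
    constructor
    · rintro ⟨rfl, rfl, h, -⟩
      exact ⟨rfl, h, Or.inl ⟨trivial, rfl⟩⟩
    · rintro ⟨rfl, h, ⟨-, rfl⟩ | ⟨_, ⟨h, -⟩, -⟩⟩
      · exact ⟨rfl, rfl, h, List.isChain_singleton _⟩
      · exact absurd h (by simp)
  · have hhead : (c ++ [x] ++ [R]).head? = (c ++ [x]).head? := by
      cases c <;> simp
    simp only [List.concat_eq_append, LPath, hhead, List.getLast?_concat, Option.some.injEq]
    unfold List.Chain'
    rw [List.isChain_append]
    simp only [List.mem_append, List.mem_singleton, List.getLast?_concat, Option.mem_def,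
      Option.some.injEq, List.head?_cons, List.isChain_singleton]
    constructor
    · rintro ⟨h1, rfl, h2, h3, -, h4⟩
      exact ⟨rfl, h2 _ (Or.inr rfl), Or.inr ⟨x, ⟨h1, rfl, fun p hp => h2 p (Or.inl hp), h3⟩,
        h4 x rfl _ rfl⟩⟩
    · rintro ⟨rfl, h, ⟨h0, -⟩ | ⟨_, ⟨h1, rfl, h2, h3⟩, h4⟩⟩
      · simp at h0
      · refine ⟨h1, rfl, ?_, h3, trivial, ?_⟩
        · rintro p (hp | rfl)
          · exact h2 p hp
          · exact h
        · rintro _ rfl _ rfl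
          exact h4

theorem LPath.ne_nil {Y : Set (ℤ × ℤ)} {P Q : ℤ × ℤ} {c : List (ℤ × ℤ)}
    (h : LPath Y P Q c) : c ≠ [] := by
  rintro rfl
  simpa using h.1

theorem LPath.start_mem {Y : Set (ℤ × ℤ)} {P Q : ℤ × ℤ} {c : List (ℤ × ℤ)}
    (h : LPath Y P Q c) : P ∈ c :=
  List.mem_of_mem_head? h.1

theorem LPath.end_mem {Y : Set (ℤ × ℤ)} {P Q : ℤ × ℤ} {c : List (ℤ × ℤ)}
    (h : LPath Y P Q c) : Q ∈ c :=
  List.mem_of_getLast? h.2.1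

theorem lPath_singleton {Y : Set (ℤ × ℤ)} {P : ℤ × ℤ} (h : P ∈ Y) : LPath Y P P [P] :=
  ⟨rfl, rfl, by simpa using h, List.isChain_singleton _⟩

/-- The difference of the coordinates strictly decreases along a path. -/
theorem LPath.eq_end_or_lt {Y : Set (ℤ × ℤ)} {P Q p : ℤ × ℤ} {c : List (ℤ × ℤ)}
    (h : LPath Y P Q c) (hp : p ∈ c) : p = Q ∨ Q.2 - Q.1 < p.2 - p.1 := by
  induction c using List.reverseRecOn generalizing Q with
  | nil => simp at hp
  | append_singleton c R ih =>
    obtain ⟨rfl, -, h⟩ := lPath_snoc_iff.1 h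
    rcases List.mem_append.1 hp with hp | hp
    · right
      rcases h with ⟨rfl, -⟩ | ⟨Q', h, hs⟩
      · simp at hp
      · have : Q'.2 - Q'.1 ≤ p.2 - p.1 := by
          rcases ih h hp with rfl | h
          · exact le_rfl
          · exact h.le
        rcases hs with rfl | rfl <;> simp only <;> omega
    · left
      simpa using hp

/-- A path between two points on the same antidiagonal is constant. -/
theorem LPath.eq_singleton {Y : Set (ℤ × ℤ)} {P Q : ℤ × ℤ} {c : List (ℤ × ℤ)}
    (h : LPath Y P Q c) (hPQ : P.2 - P.1 = Q.2 - Q.1) : c = [P] ∧ P = Q := by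
  have hP : P = Q := (h.eq_end_or_lt h.start_mem).resolve_right (by omega)
  subst hP
  rcases List.eq_nil_or_concat c with rfl | ⟨c, x, rfl⟩
  · exact absurd rfl h.ne_nil
  · rw [List.concat_eq_append] at h ⊢
    obtain ⟨rfl, -, ⟨rfl, -⟩ | ⟨Q', h, hs⟩⟩ := lPath_snoc_iff.1 h
    · simp
    · exfalso
      have := h.eq_end_or_lt h.start_mem
      rcases hs with hs | hs <;> rw [Prod.ext_iff] at hs <;> rcases this with rfl | h <;>
        simp only at hs <;> omega

theorem ibinom_pascal {N : ℤ} (hN : 1 ≤ N) (x : ℤ) :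
    ibinom N x = ibinom (N - 1) x + ibinom (N - 1) (x - 1) := by
  obtain ⟨n, rfl⟩ : ∃ n : ℕ, N = n + 1 := ⟨(N - 1).toNat, by omega⟩
  rcases lt_trichotomy x 0 with hx | rfl | hx
  · simp [ibinom, not_le.2 hx, show ¬ 1 ≤ x by omega]
  · have : (0 : ℤ) ≤ n + 1 := by omega
    simp [ibinom, this]
  · obtain ⟨m, rfl⟩ : ∃ m : ℕ, x = m + 1 := ⟨(x - 1).toNat, by omega⟩
    have h1 : ((n : ℤ) + 1).toNat = n + 1 := by omega
    have h2 : ((m : ℤ) + 1).toNat = m + 1 := by omega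
    have h3 : (0 : ℤ) ≤ n + 1 := by omega
    have h4 : (0 : ℤ) ≤ m + 1 := by omega
    simp [ibinom, h1, h2, h3, h4, Nat.choose_succ_succ, add_comm]

theorem ibinom_of_neg {N x : ℤ} (hx : x < 0) : ibinom N x = 0 := by
  simp [ibinom, not_le.2 hx]

theorem ibinom_zero_of_pos {x : ℤ} (hx : 0 < x) : ibinom 0 x = 0 := by
  have : 0 < x.toNat := by omega
  simp [ibinom, Nat.choose_eq_zero_of_lt this]

theorem ibinom_zero_right {N : ℤ} (hN : 0 ≤ N) : ibinom N 0 = 1 := by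
  simp [ibinom, hN]

/-- Pascal's rule applied to every column of a binomial determinant. -/
theorem det_ibinom_eq_sum {k : ℕ} (a b : Fin k → ℤ) (d : ℤ) (ha : ∀ i, d + 1 ≤ a i) :
    Matrix.det (Matrix.of fun i j : Fin k => ibinom (a i - d) (b j)) =
      ∑ s : Finset (Fin k), Matrix.det (Matrix.of fun i j : Fin k =>
        ibinom (a i - (d + 1)) (s.piecewise b (fun j => b j - 1) j)) := by
  have h := (Matrix.detRowAlternating (n := Fin k) (R := ℤ)).toMultilinearMap.map_add_univ
    (fun j i => ibinom (a i - (d + 1)) (b j)) (fun j i => ibinom (a i - (d + 1)) (b j - 1))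
  rw [← Matrix.det_transpose]
  refine Eq.trans ?_ (h.trans (Finset.sum_congr rfl fun s _ => ?_))
  · refine congrArg Matrix.det ?_
    ext j i
    simp only [Matrix.transpose_apply, Matrix.of_apply, Pi.add_apply]
    rw [ibinom_pascal (by linarith [ha i]), sub_sub]
  · rw [← Matrix.det_transpose]
    refine congrArg Matrix.det ?_
    ext j i
    by_cases hj : j ∈ s <;> simp [hj]

/-- The tuples of pairwise non-intersecting paths in `Y` from `P i` to `Q i`. -/
abbrev NIPTuple (Y : Set (ℤ × ℤ)) {r : ℕ} (P Q : Fin r → ℤ × ℤ) : Type :=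
  {C : Fin r → List (ℤ × ℤ) //
    (∀ i, LPath Y (P i) (Q i) (C i)) ∧ ∀ i j, i ≠ j → ∀ p ∈ C i, p ∉ C j}

theorem isEmpty_nipTuple_of_end_eq {Y : Set (ℤ × ℤ)} {r : ℕ} {P Q : Fin r → ℤ × ℤ}
    {i j : Fin r} (hij : i ≠ j) (h : Q i = Q j) : IsEmpty (NIPTuple Y P Q) := by
  refine ⟨fun ⟨C, hC, hd⟩ => hd i j hij (Q i) (hC i).end_mem ?_⟩
  rw [h]
  exact (hC j).end_mem

section

variable {k : ℕ} {a b : Fin k → ℤ} {d : ℤ}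

/-- The endpoint condition after removing the last step: `s` is the set of paths whose last step
is vertical. -/
theorem lPath_snoc_of_piecewise (hd : 0 ≤ d) (s : Finset (Fin k)) (i : Fin k)
    {c : List (ℤ × ℤ)}
    (h : LPath {p : ℤ × ℤ | 0 ≤ p.1 ∧ p.1 ≤ p.2} (0, a i)
      (s.piecewise b (fun j => b j - 1) i, s.piecewise b (fun j => b j - 1) i + (d + 1)) c) :
    LPath {p : ℤ × ℤ | 0 ≤ p.1 ∧ p.1 ≤ p.2} (0, a i) (b i, b i + d)
      (c ++ [(b i, b i + d)]) := by
  have hm := h.2.2.1 _ h.end_mem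
  simp only [Set.mem_ofPred_eq] at hm
  refine lPath_snoc_iff.2 ⟨rfl, ?_, Or.inr ⟨_, h, ?_⟩⟩
  · by_cases hi : i ∈ s <;> (simp [hi] at hm ⊢; omega)
  · by_cases hi : i ∈ s <;> simp [hi] <;> omega

/-- Append the last points to a tuple of paths ending on the previous antidiagonal. -/
def nipSnoc (hb : StrictMono b) (hd : 0 ≤ d) :
    (Σ s : Finset (Fin k), NIPTuple {p : ℤ × ℤ | 0 ≤ p.1 ∧ p.1 ≤ p.2} (fun i => ((0 : ℤ), a i))
      (fun i => (s.piecewise b (fun j => b j - 1) i,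
        s.piecewise b (fun j => b j - 1) i + (d + 1)))) →
    NIPTuple {p : ℤ × ℤ | 0 ≤ p.1 ∧ p.1 ≤ p.2} (fun i => ((0 : ℤ), a i))
      (fun i => (b i, b i + d)) :=
  fun C => ⟨fun i => C.2.1 i ++ [(b i, b i + d)],
    fun i => lPath_snoc_of_piecewise hd C.1 i (C.2.2.1 i), by
      have hlast : ∀ i j, (b i, b i + d) ∉ C.2.1 j := fun i j h => by
        have := (C.2.2.1 j).eq_end_or_lt h
        simp only [Prod.mk.injEq] at this
        omega
      intro i j hij p hp hq
      rcases List.mem_append.1 hp with hp | hp <;> rcases List.mem_append.1 hq with hq | hq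
      · exact C.2.2.2 i j hij p hp hq
      · rw [List.mem_singleton.1 hq] at hp
        exact hlast _ _ hp
      · rw [List.mem_singleton.1 hp] at hq
        exact hlast _ _ hq
      · have := (List.mem_singleton.1 hp).symm.trans (List.mem_singleton.1 hq)
        exact hij (hb.injective (Prod.ext_iff.1 this).1)⟩

theorem nipSnoc_bijective (ha : ∀ i, d + 1 ≤ a i) (hb : StrictMono b) (hd : 0 ≤ d) :
    Function.Bijective (nipSnoc (a := a) hb hd) := by
  constructor
  · rintro ⟨s, C, hC, hC'⟩ ⟨t, D, hD, hD'⟩ h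
    have hCD : C = D := funext fun i =>
      List.append_cancel_right (congrFun (congrArg Subtype.val h) i)
    subst hCD
    have hst : s = t := by
      ext i
      have := Option.some.inj ((hC i).2.1.symm.trans (hD i).2.1)
      by_cases hs : i ∈ s <;> by_cases ht : i ∈ t <;> simp [hs, ht] at this ⊢
    subst hst
    rfl
  · rintro ⟨C, hC, hC'⟩
    have key : ∀ i, ∃ c : List (ℤ × ℤ), C i = c ++ [(b i, b i + d)] ∧
        ∃ v : Prop, (v → LPath {p : ℤ × ℤ | 0 ≤ p.1 ∧ p.1 ≤ p.2} (0, a i)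
          (b i, b i + (d + 1)) c) ∧ (¬ v → LPath {p : ℤ × ℤ | 0 ≤ p.1 ∧ p.1 ≤ p.2} (0, a i)
          (b i - 1, b i - 1 + (d + 1)) c) := by
      intro i
      have h := hC i
      rcases List.eq_nil_or_concat (C i) with h0 | ⟨c, x, hc⟩
      · exact absurd h0 h.ne_nil
      · rw [List.concat_eq_append] at hc
        rw [hc] at h ⊢
        obtain ⟨rfl, -, ⟨-, h⟩ | ⟨⟨x, y⟩, h, hs⟩⟩ := lPath_snoc_iff.1 h
        · simp only [Prod.mk.injEq] at h
          linarith [ha i]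
        · refine ⟨c, rfl, ?_⟩
          simp only [Prod.mk.injEq] at hs
          rcases hs with ⟨h1, h2⟩ | ⟨h1, h2⟩
          · refine ⟨False, False.elim, fun _ => ?_⟩
            convert h using 2 <;> omega
          · refine ⟨True, fun _ => ?_, fun h => absurd trivial h⟩
            convert h using 2 <;> omega
    choose c hc v hv hv' using key
    classical
    refine ⟨⟨Finset.univ.filter v, c, fun i => ?_, fun i j hij p hp hq => ?_⟩, ?_⟩
    · by_cases h : v i
      · simpa [h] using hv i h
      · simpa [h] using hv' i h
    · refine hC' i j hij p ?_ ?_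
      · rw [hc]; exact List.mem_append_left _ hp
      · rw [hc]; exact List.mem_append_left _ hq
    · exact Subtype.ext (funext fun i => (hc i).symm)

end

/-- Prepend the constant path at `(0, d)`. -/
def nipCons {k : ℕ} {a b : Fin (k + 1) → ℤ} {d : ℤ} (ha : a 0 = d) (hb0 : b 0 = 0)
    (hb : StrictMono b) (hd : 0 ≤ d) :
    NIPTuple {p : ℤ × ℤ | 0 ≤ p.1 ∧ p.1 ≤ p.2} (fun i : Fin k => ((0 : ℤ), a i.succ))
      (fun i => (b i.succ, b i.succ + d)) →
    NIPTuple {p : ℤ × ℤ | 0 ≤ p.1 ∧ p.1 ≤ p.2} (fun i => ((0 : ℤ), a i))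
      (fun i => (b i, b i + d)) :=
  fun C => ⟨Fin.cons [(0, d)] C.1, by
    refine Fin.cases ?_ fun i => ?_
    · simp only [Fin.cons_zero, ha, hb0, zero_add]
      exact lPath_singleton ⟨le_rfl, hd⟩
    · exact C.2.1 i, by
    have hlast : ∀ j, (0, d) ∉ C.1 j := fun j h => by
      have := (C.2.1 j).eq_end_or_lt h
      have := hb (Fin.succ_pos j)
      simp only [Prod.mk.injEq] at *
      omega
    intro i j
    refine Fin.cases ?_ (fun i => ?_) i <;> refine Fin.cases ?_ (fun j => ?_) j
    · simp
    · intro _ p hp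
      rw [Fin.cons_zero, List.mem_singleton] at hp
      rw [hp]
      exact hlast j
    · intro _ p hp hq
      rw [Fin.cons_zero, List.mem_singleton] at hq
      rw [hq] at hp
      exact hlast i hp
    · intro hij
      exact C.2.2 i j fun h => hij (congrArg _ h)⟩

theorem nipCons_bijective {k : ℕ} {a b : Fin (k + 1) → ℤ} {d : ℤ} (ha : a 0 = d) (hb0 : b 0 = 0)
    (hb : StrictMono b) (hd : 0 ≤ d) : Function.Bijective (nipCons ha hb0 hb hd) := by
  constructor
  · intro C D h
    exact Subtype.ext (funext fun i => congrFun (congrArg Subtype.val h) i.succ)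
  · rintro ⟨C, hC, hC'⟩
    refine ⟨⟨fun i => C i.succ, fun i => hC i.succ,
      fun i j hij => hC' _ _ fun h => hij (Fin.succ_injective _ h)⟩, Subtype.ext ?_⟩
    have h0 : C 0 = [(0, d)] := by
      have := ((hC 0).eq_singleton (by simp [ha])).1
      simpa only [ha] using this
    funext i
    refine Fin.cases ?_ (fun i => ?_) i
    · exact h0.symm
    · rfl

/-- Non-intersecting paths ending on a given antidiagonal are counted by a binomial
determinant. -/
theorem finite_and_card_nipTuple (N : ℕ) : ∀ (k : ℕ) (a b : Fin k → ℤ) (d : ℤ), 0 ≤ d →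
    (∀ i, a i - d + k ≤ N) → StrictMono a → (∀ i, d ≤ a i) → StrictMono b →
    Finite (NIPTuple {p : ℤ × ℤ | 0 ≤ p.1 ∧ p.1 ≤ p.2} (fun i => ((0 : ℤ), a i))
      (fun i => (b i, b i + d))) ∧
    (Nat.card (NIPTuple {p : ℤ × ℤ | 0 ≤ p.1 ∧ p.1 ≤ p.2} (fun i => ((0 : ℤ), a i))
      (fun i => (b i, b i + d))) : ℤ) =
      Matrix.det (Matrix.of fun i j : Fin k => ibinom (a i - d) (b j)) := by
  induction N with
  | zero =>
    intro k a b d hd hN ha had hb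
    cases k with
    | zero =>
      have : Unique (NIPTuple {p : ℤ × ℤ | 0 ≤ p.1 ∧ p.1 ≤ p.2} (fun i => ((0 : ℤ), a i))
          (fun i => (b i, b i + d))) :=
        ⟨⟨⟨Fin.elim0, fun i => i.elim0, fun i => i.elim0⟩⟩, fun C => Subsingleton.elim _ _⟩
      exact ⟨inferInstance, by simp⟩
    | succ k =>
      have h1 := hN 0
      have h2 := had 0
      push_cast at h1
      omega
  | succ N ih =>
    intro k a b d hd hN ha had hb
    by_cases hlt : ∀ i, d + 1 ≤ a i
    · have key : ∀ s : Finset (Fin k),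
          Finite (NIPTuple {p : ℤ × ℤ | 0 ≤ p.1 ∧ p.1 ≤ p.2} (fun i => ((0 : ℤ), a i))
            (fun i => (s.piecewise b (fun j => b j - 1) i,
              s.piecewise b (fun j => b j - 1) i + (d + 1)))) ∧
          (Nat.card (NIPTuple {p : ℤ × ℤ | 0 ≤ p.1 ∧ p.1 ≤ p.2} (fun i => ((0 : ℤ), a i))
            (fun i => (s.piecewise b (fun j => b j - 1) i,
              s.piecewise b (fun j => b j - 1) i + (d + 1)))) : ℤ) =
          Matrix.det (Matrix.of fun i j : Fin k =>
            ibinom (a i - (d + 1)) (s.piecewise b (fun j => b j - 1) j)) := by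
        intro s
        by_cases hs : Function.Injective (s.piecewise b (fun j => b j - 1))
        · refine ih k a _ (d + 1) (by omega) (fun i => ?_) ha hlt
            (Monotone.strictMono_of_injective (fun i j hij => ?_) hs)
          · have := hN i
            push_cast at this
            omega
          · rcases hij.eq_or_lt with rfl | hij
            · exact le_rfl
            · have := hb hij
              by_cases hi : i ∈ s <;> by_cases hj : j ∈ s <;> simp [hi, hj] <;> omega
        · obtain ⟨i, j, h, hij⟩ : ∃ i j, s.piecewise b (fun j => b j - 1) i =
              s.piecewise b (fun j => b j - 1) j ∧ i ≠ j := by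
            simpa [Function.Injective] using hs
          have := isEmpty_nipTuple_of_end_eq (Y := {p : ℤ × ℤ | 0 ≤ p.1 ∧ p.1 ≤ p.2})
            (P := fun i => ((0 : ℤ), a i))
            (Q := fun i => (s.piecewise b (fun j => b j - 1) i,
              s.piecewise b (fun j => b j - 1) i + (d + 1))) hij (by simp only [h])
          refine ⟨inferInstance, ?_⟩
          rw [Nat.card_of_isEmpty, Nat.cast_zero, eq_comm]
          exact Matrix.det_zero_of_column_eq hij fun l => by simp only [Matrix.of_apply, h]
      have hbij := nipSnoc_bijective (a := a) hlt hb hd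
      have := fun s => (key s).1
      refine ⟨Finite.of_surjective _ hbij.2, ?_⟩
      rw [← Nat.card_eq_of_bijective _ hbij, Nat.card_sigma, det_ibinom_eq_sum a b d hlt,
        Nat.cast_sum]
      exact Finset.sum_congr rfl fun s _ => (key s).2
    · cases k with
      | zero => exact absurd (fun i => i.elim0) hlt
      | succ k =>
        have ha0 : a 0 = d := by
          push Not at hlt
          obtain ⟨i, hi⟩ := hlt
          have h1 := had 0
          have h2 := ha.monotone (Fin.zero_le i)
          omega
        by_cases hb0 : b 0 = 0
        · have hbij := nipCons_bijective ha0 hb0 hb hd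
          obtain ⟨hfin, hcard⟩ := ih k (fun i => a i.succ) (fun i => b i.succ) d hd
            (fun i => by have := hN i.succ; push_cast at this; omega)
            (fun i j hij => ha (Fin.succ_lt_succ_iff.2 hij)) (fun i => had _)
            (fun i j hij => hb (Fin.succ_lt_succ_iff.2 hij))
          refine ⟨Finite.of_surjective _ hbij.2, ?_⟩
          rw [← Nat.card_eq_of_bijective _ hbij, hcard, Matrix.det_succ_row_zero,
            Fin.sum_univ_succ, Finset.sum_eq_zero]
          · simp [ha0, hb0, ibinom_zero_right]
            rfl
          · intro j _
            have : ibinom 0 (b j.succ) = 0 :=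
              ibinom_zero_of_pos (hb0 ▸ hb (Fin.succ_pos j))
            simp [ha0, this]
        · have : IsEmpty (NIPTuple {p : ℤ × ℤ | 0 ≤ p.1 ∧ p.1 ≤ p.2} (fun i => ((0 : ℤ), a i))
              (fun i => (b i, b i + d))) := by
            refine ⟨fun ⟨C, hC, _⟩ => hb0 ?_⟩
            have := ((hC 0).eq_singleton (by simp [ha0])).2
            exact (Prod.ext_iff.1 this).1.symm
          refine ⟨inferInstance, ?_⟩
          rw [Nat.card_of_isEmpty, Nat.cast_zero, eq_comm]
          rcases lt_or_gt_of_ne hb0 with h | h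
          · exact Matrix.det_eq_zero_of_column_eq_zero 0 fun i => ibinom_of_neg h
          · refine Matrix.det_eq_zero_of_row_eq_zero 0 fun j => ?_
            rw [Matrix.of_apply, ha0, sub_self]
            exact ibinom_zero_of_pos (h.trans_le (hb.monotone (Fin.zero_le j)))


theorem stmt5 (k : ℕ) (a b : Fin k → ℤ)
    (ha : StrictMono a) (ha0 : ∀ i, 0 ≤ a i)
    (hb : StrictMono b) (hb0 : ∀ i, 0 ≤ b i)
    (W : Set (ℤ × ℤ)) (hW : W = {p : ℤ × ℤ | 0 ≤ p.1 ∧ p.1 ≤ p.2}) :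
    (nipCount W (fun i => ((0 : ℤ), a i)) (fun i => (b i, b i)) : ℤ) =
      Matrix.det (Matrix.of fun i j : Fin k => ibinom (a i) (b j)) := by
  subst hW
  have h : ∃ N : ℕ, ∀ i, a i - 0 + k ≤ N := by
    refine ⟨(∑ i, a i + k).toNat, fun i => ?_⟩
    have := Finset.single_le_sum (fun j _ => ha0 j) (Finset.mem_univ i)
    omega
  obtain ⟨N, hN⟩ := h
  have h := (finite_and_card_nipTuple N k a b 0 le_rfl hN ha ha0 hb).2
  simp only [sub_zero, add_zero] at h
  exact h
end

section
/- Let m, n, k, l be non-negative integers with k ≤ min(m−2, n−2) and l ≤ min(m−2, n−2), and let Y = {(i,j) ∈ ℤ×ℤ : 1 ≤ i ≤ m, max(1, l+2−i) ≤ j ≤ min(n, n+m−k−i)} be the two-sided diagonal ladder. Let P = (1, n) and Q = (m, 1). Then the number of paths in Y from P to Q equals Σ_{(a,b)∈T} (−1)^{a+b} C(m+n−2, m−1+a(k−m)+b(l−n)). -/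
theorem ibinom_eq_zero {N : ℕ} {x : ℤ} (h : x < 0 ∨ N < x) : ibinom N x = 0 := by
  unfold ibinom
  split_ifs with h'
  · rw [Int.toNat_natCast, Nat.choose_eq_zero_of_lt (by omega), Nat.cast_zero]
  · rfl

theorem ibinom_succ (N : ℕ) (x : ℤ) :
    ibinom (N + 1 : ℕ) x = ibinom N (x - 1) + ibinom N x := by
  rcases lt_trichotomy x 0 with h | rfl | h
  · simp only [ibinom_eq_zero (Or.inl h), ibinom_eq_zero (Or.inl (show x - 1 < 0 by omega)),
      add_zero]
  · rw [ibinom_eq_zero (x := 0 - 1) (by omega)]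
    simp [ibinom]
    omega
  · obtain ⟨y, rfl⟩ : ∃ y : ℕ, x = y + 1 := ⟨(x - 1).toNat, by omega⟩
    have h1 : ((y : ℤ) + 1).toNat = y + 1 := by omega
    simp only [ibinom, Int.toNat_natCast, h1, add_sub_cancel_right]
    rw [if_pos (by omega), if_pos (by omega), if_pos (by omega), Nat.choose_succ_succ]
    push_cast
    rfl

theorem ibinom_symm (N : ℕ) (x : ℤ) : ibinom N (N - x) = ibinom N x := by
  by_cases h : x < 0 ∨ N < x
  · rw [ibinom_eq_zero h, ibinom_eq_zero (by omega)]
  · have h1 : ((N : ℤ) - x).toNat = N - x.toNat := by omega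
    simp only [ibinom, Int.toNat_natCast, h1]
    rw [if_pos (by omega), if_pos (by omega), Nat.choose_symm (by omega)]

/-- The sum of the binomial coefficients `C(N, y)` over all `y` congruent to `x` modulo `W`. -/
noncomputable def residueSum (W : ℤ) (N : ℕ) (x : ℤ) : ℤ :=
  ∑ᶠ t : ℤ, ibinom N (x + t * W)

theorem finite_support_ibinom {W : ℤ} (hW : 0 < W) (N : ℕ) (x : ℤ) :
    (Function.support fun t : ℤ => ibinom N (x + t * W)).Finite := by
  refine (Set.finite_Icc (-|x|) (N + |x|)).subset fun t ht => ?_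
  have h : ¬ (x + t * W < 0 ∨ N < x + t * W) := fun h => ht (ibinom_eq_zero h)
  have := neg_abs_le x
  have := le_abs_self x
  constructor <;> by_contra! <;> apply h
  · left
    nlinarith [abs_nonneg x]
  · right
    nlinarith [abs_nonneg x]

theorem residueSum_succ {W : ℤ} (hW : 0 < W) (N : ℕ) (x : ℤ) :
    residueSum W (N + 1) x = residueSum W N (x - 1) + residueSum W N x := by
  unfold residueSum
  rw [← finsum_add_distrib (finite_support_ibinom hW N _) (finite_support_ibinom hW N _)]
  refine finsum_congr fun t => ?_
  rw [ibinom_succ]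
  congr 2
  ring

theorem residueSum_add_self (W : ℤ) (N : ℕ) (x : ℤ) :
    residueSum W N (x + W) = residueSum W N x := by
  unfold residueSum
  rw [← finsum_comp_equiv (Equiv.addRight (1 : ℤ)) (f := fun t => ibinom N (x + t * W))]
  refine finsum_congr fun t => ?_
  simp only [Equiv.coe_addRight]
  congr 1
  ring

theorem residueSum_eq_finsum_sub (W : ℤ) (N : ℕ) (x : ℤ) :
    residueSum W N x = ∑ᶠ t : ℤ, ibinom N (x - t * W) := by
  unfold residueSum
  rw [← finsum_comp_equiv (Equiv.neg ℤ)]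
  refine finsum_congr fun t => ?_
  simp only [Equiv.neg_apply]
  congr 1
  ring

theorem residueSum_symm (W : ℤ) (N : ℕ) (x : ℤ) :
    residueSum W N (N - x) = residueSum W N x := by
  rw [residueSum_eq_finsum_sub, residueSum]
  refine finsum_congr fun t => ?_
  rw [← ibinom_symm]
  congr 1
  ring

theorem residueSum_zero_zero {W : ℤ} (hW : 0 < W) : residueSum W 0 0 = 1 := by
  unfold residueSum
  rw [finsum_eq_single _ 0]
  · simp [ibinom]
  · intro t ht
    apply ibinom_eq_zero
    have : t * W ≠ 0 := mul_ne_zero ht hW.ne'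
    push_cast
    omega

theorem residueSum_zero_of_not_dvd {W x : ℤ} (h : ¬ W ∣ x) : residueSum W 0 x = 0 := by
  refine finsum_eq_zero_of_forall_eq_zero fun t => ibinom_eq_zero ?_
  have : x + t * W ≠ 0 := fun h' => h ⟨-t, by linarith⟩
  push_cast
  omega

theorem residueSum_zero_of_abs_lt {W x : ℤ} (h0 : x ≠ 0) (h : |x| < W) :
    residueSum W 0 x = 0 :=
  residueSum_zero_of_not_dvd fun hd => h0 (Int.eq_zero_of_abs_lt_dvd hd h)

theorem finsum_mem_Tset (f : ℤ × ℤ → ℤ)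
    (h₁ : (Function.support fun b : ℤ => f (b, b)).Finite)
    (h₂ : (Function.support fun b : ℤ => f (b + 1, b)).Finite) :
    ∑ᶠ p ∈ Tset, f p = ∑ᶠ b : ℤ, f (b, b) + ∑ᶠ b : ℤ, f (b + 1, b) := by
  have hT : Tset = Set.range (fun b : ℤ => (b, b)) ∪ Set.range (fun b : ℤ => (b + 1, b)) := by
    ext ⟨a, b⟩
    simp only [Tset, Set.mem_ofPred_eq, Set.mem_union, Set.mem_range, Prod.mk.injEq]
    constructor
    · rintro (h | h)
      · exact Or.inl ⟨b, by omega, rfl⟩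
      · exact Or.inr ⟨b, by omega, rfl⟩
    · rintro (⟨y, h, h'⟩ | ⟨y, h, h'⟩) <;> omega
  have inj₁ : Function.Injective (fun b : ℤ => (b, b)) := fun a b h => (Prod.mk.inj h).2
  have inj₂ : Function.Injective (fun b : ℤ => (b + 1, b)) := fun a b h => (Prod.mk.inj h).2
  rw [hT, finsum_mem_union', finsum_mem_range inj₁, finsum_mem_range inj₂]
  · rw [Set.disjoint_left]
    rintro _ ⟨a, rfl⟩ ⟨b, h⟩
    simp only [Prod.mk.injEq] at h
    omega
  · refine (h₁.image fun b => (b, b)).subset ?_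
    rintro _ ⟨⟨b, rfl⟩, hb⟩
    exact ⟨b, hb, rfl⟩
  · refine (h₂.image fun b => (b + 1, b)).subset ?_
    rintro _ ⟨⟨b, rfl⟩, hb⟩
    exact ⟨b, hb, rfl⟩

theorem setOf_LPath_of_notMem {Y : Set (ℤ × ℤ)} {P Q : ℤ × ℤ} (hP : P ∉ Y) :
    {c | LPath Y P Q c} = ∅ := by
  refine Set.eq_empty_of_forall_notMem fun c hc => hP ?_
  exact hc.2.2.1 P (List.mem_of_head? hc.1)

theorem LPath_cons_iff {Y : Set (ℤ × ℤ)} {P Q a : ℤ × ℤ} {c : List (ℤ × ℤ)} :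
    LPath Y P Q (a :: c) ↔ a = P ∧ P ∈ Y ∧ ((c = [] ∧ P = Q) ∨
      LPath Y (P.1 + 1, P.2) Q c ∨ LPath Y (P.1, P.2 - 1) Q c) := by
  unfold LPath List.Chain'
  cases c with
  | nil =>
    simp
    grind
  | cons b c =>
    simp only [List.head?_cons, Option.some.injEq, List.getLast?_cons_cons, List.forall_mem_cons,
      List.isChain_cons_cons, reduceCtorEq, false_and, false_or]
    grind

theorem setOf_LPath_self {Y : Set (ℤ × ℤ)} {Q : ℤ × ℤ} (hQ : Q ∈ Y)
    (h₁ : (Q.1 + 1, Q.2) ∉ Y) (h₂ : (Q.1, Q.2 - 1) ∉ Y) :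
    {c | LPath Y Q Q c} = {[Q]} := by
  ext c
  cases c with
  | nil => simp [LPath]
  | cons a c =>
    have e₁ := Set.eq_empty_iff_forall_notMem.1 (setOf_LPath_of_notMem (Q := Q) h₁) c
    have e₂ := Set.eq_empty_iff_forall_notMem.1 (setOf_LPath_of_notMem (Q := Q) h₂) c
    simp only [Set.mem_ofPred_eq] at e₁ e₂
    simp [LPath_cons_iff, e₁, e₂, hQ]

theorem setOf_LPath_of_ne {Y : Set (ℤ × ℤ)} {P Q : ℤ × ℤ} (hP : P ∈ Y) (hne : P ≠ Q) :
    {c | LPath Y P Q c} = List.cons P '' {c | LPath Y (P.1 + 1, P.2) Q c} ∪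
      List.cons P '' {c | LPath Y (P.1, P.2 - 1) Q c} := by
  ext c
  cases c with
  | nil => simp [LPath]
  | cons a c =>
    simp only [Set.mem_ofPred_eq, LPath_cons_iff, hP, hne, and_false, true_and, false_or,
      Set.mem_union, Set.mem_image, List.cons.injEq]
    grind

/-- The paths from `P` to `Q` in `Y` are finite in number, and their number is `v`. -/
def HasPathCount (Y : Set (ℤ × ℤ)) (P Q : ℤ × ℤ) (v : ℤ) : Prop :=
  {c | LPath Y P Q c}.Finite ∧ ({c | LPath Y P Q c}.ncard : ℤ) = v

theorem HasPathCount.unique {Y : Set (ℤ × ℤ)} {P Q : ℤ × ℤ} {v w : ℤ}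
    (hv : HasPathCount Y P Q v) (hw : HasPathCount Y P Q w) : v = w :=
  hv.2.symm.trans hw.2

theorem hasPathCount_of_notMem {Y : Set (ℤ × ℤ)} {P Q : ℤ × ℤ} (hP : P ∉ Y) :
    HasPathCount Y P Q 0 := by
  simp [HasPathCount, setOf_LPath_of_notMem hP]

theorem hasPathCount_self {Y : Set (ℤ × ℤ)} {Q : ℤ × ℤ} (hQ : Q ∈ Y)
    (h₁ : (Q.1 + 1, Q.2) ∉ Y) (h₂ : (Q.1, Q.2 - 1) ∉ Y) : HasPathCount Y Q Q 1 := by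
  simp [HasPathCount, setOf_LPath_self hQ h₁ h₂]

theorem HasPathCount.step {Y : Set (ℤ × ℤ)} {P Q : ℤ × ℤ} {v w : ℤ} (hP : P ∈ Y) (hne : P ≠ Q)
    (hv : HasPathCount Y (P.1 + 1, P.2) Q v) (hw : HasPathCount Y (P.1, P.2 - 1) Q w) :
    HasPathCount Y P Q (v + w) := by
  unfold HasPathCount
  rw [setOf_LPath_of_ne hP hne]
  refine ⟨(hv.1.image _).union (hw.1.image _), ?_⟩
  rw [Set.ncard_union_eq ?_ (hv.1.image _) (hw.1.image _),
    Set.ncard_image_of_injective _ (List.cons_injective),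
    Set.ncard_image_of_injective _ (List.cons_injective), Nat.cast_add, hv.2, hw.2]
  rw [Set.disjoint_left]
  rintro _ ⟨c, hc, rfl⟩ ⟨d, hd, h⟩
  obtain rfl := List.cons_injective h
  have := Option.some.inj (hc.1.symm.trans hd.1)
  simp at this

/-- The reflection principle for two barriers: at every point of the closed strip bounded by the
lines `i + j = l + 1` and `i + j = n + m - k + 1`, the paths to `(m, 1)` are counted by a
difference of two sums of binomial coefficients. -/
theorem hasPathCount_ladder {m n k l : ℤ}
    (hk : k ≤ min (m - 2) (n - 2)) (hl : l ≤ min (m - 2) (n - 2)) {Y : Set (ℤ × ℤ)}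
    (hY : Y = {p : ℤ × ℤ | 1 ≤ p.1 ∧ p.1 ≤ m ∧
      max 1 (l + 2 - p.1) ≤ p.2 ∧ p.2 ≤ min n (n + m - k - p.1)}) (N : ℕ) (i j : ℤ)
    (hi : 1 ≤ i) (hj : j ≤ n) (hN : (N : ℤ) = m - i + j - 1)
    (hlo : l + 1 ≤ i + j) (hhi : i + j ≤ n + m - k + 1) :
    HasPathCount Y (i, j) (m, 1)
      (residueSum (m + n - k - l) N (m - i) - residueSum (m + n - k - l) N (l - i)) := by
  have hW : 0 < m + n - k - l := by omega
  have mem : ∀ a b : ℤ, (a, b) ∈ Y ↔ 1 ≤ a ∧ a ≤ m ∧ 1 ≤ b ∧ b ≤ n ∧ l + 2 ≤ a + b ∧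
      a + b ≤ n + m - k := by
    intro a b
    rw [hY, Set.mem_ofPred_eq]
    omega
  have boundary : ∀ (N : ℕ) (i j : ℤ), (N : ℤ) = m - i + j - 1 →
      l + 1 = i + j ∨ i + j = n + m - k + 1 → HasPathCount Y (i, j) (m, 1)
      (residueSum (m + n - k - l) N (m - i) - residueSum (m + n - k - l) N (l - i)) := by
    intro N i j hN h
    have hnot : (i, j) ∉ Y := by rw [mem]; omega
    convert hasPathCount_of_notMem hnot using 1
    rw [← residueSum_symm _ N (m - i), sub_eq_zero]
    rcases h with h | h
    · rw [show (N : ℤ) - (m - i) = l - i by omega]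
    · rw [show (N : ℤ) - (m - i) = l - i + (m + n - k - l) by omega, residueSum_add_self]
  induction N generalizing i j with
  | zero =>
    by_cases hb : l + 1 = i + j ∨ i + j = n + m - k + 1
    · exact boundary _ i j hN hb
    rw [residueSum_zero_of_abs_lt (x := l - i) (by omega) (by rw [abs_lt]; omega), sub_zero]
    by_cases him : i = m
    · obtain rfl : j = 1 := by omega
      subst him
      rw [sub_self, residueSum_zero_zero hW]
      apply hasPathCount_self <;> rw [mem] <;> omega
    · rw [residueSum_zero_of_abs_lt (by omega) (by rw [abs_lt]; omega)]
      exact hasPathCount_of_notMem (by rw [mem]; omega)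
  | succ N ih =>
    by_cases hb : l + 1 = i + j ∨ i + j = n + m - k + 1
    · exact boundary _ i j hN hb
    have h₁ := ih (i + 1) j (by omega) hj (by omega) (by omega) (by omega)
    have h₂ := ih i (j - 1) hi (by omega) (by omega) (by omega) (by omega)
    rw [residueSum_succ hW, residueSum_succ hW]
    rw [show m - (i + 1) = m - i - 1 by ring, show l - (i + 1) = l - i - 1 by ring] at h₁
    by_cases hij : (i, j) ∈ Y
    · have hne : (i, j) ≠ (m, 1) := by
        intro h
        rw [Prod.mk.injEq] at h
        omega
      convert HasPathCount.step hij hne h₁ h₂ using 1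
      ring
    · have hn₁ : (i + 1, j) ∉ Y := by rw [mem] at hij ⊢; omega
      have hn₂ : (i, j - 1) ∉ Y := by rw [mem] at hij ⊢; omega
      convert hasPathCount_of_notMem hij using 1
      linear_combination h₁.unique (hasPathCount_of_notMem hn₁) +
        h₂.unique (hasPathCount_of_notMem hn₂)

theorem stmt6 (m n k l : ℤ) (hk0 : 0 ≤ k) (hl0 : 0 ≤ l)
    (hk : k ≤ min (m - 2) (n - 2)) (hl : l ≤ min (m - 2) (n - 2))
    (Y : Set (ℤ × ℤ))
    (hY : Y = {p : ℤ × ℤ | 1 ≤ p.1 ∧ p.1 ≤ m ∧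
      max 1 (l + 2 - p.1) ≤ p.2 ∧ p.2 ≤ min n (n + m - k - p.1)}) :
    (pathCount Y (1, n) (m, 1) : ℤ) =
      ∑ᶠ p ∈ Tset, (-1 : ℤ) ^ (p.1 + p.2).natAbs *
        ibinom (m + n - 2) (m - 1 + p.1 * (k - m) + p.2 * (l - n)) := by
  have hW : 0 < m + n - k - l := by omega
  obtain ⟨N, hN⟩ : ∃ N : ℕ, (N : ℤ) = m + n - 2 := ⟨(m + n - 2).toNat, by omega⟩
  have hcount : (pathCount Y (1, n) (m, 1) : ℤ) = _ :=
    (hasPathCount_ladder hk hl hY N 1 n le_rfl le_rfl (by omega) (by omega) (by omega)).2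
  have term₁ : ∀ b : ℤ, (-1 : ℤ) ^ (b + b).natAbs *
      ibinom N (m - 1 + b * (k - m) + b * (l - n)) =
        ibinom N (m - 1 - b * (m + n - k - l)) := by
    intro b
    rw [Even.neg_one_pow (Int.natAbs_even.2 ⟨b, rfl⟩), one_mul]
    congr 1
    ring
  have term₂ : ∀ b : ℤ, (-1 : ℤ) ^ (b + 1 + b).natAbs *
      ibinom N (m - 1 + (b + 1) * (k - m) + b * (l - n)) =
        -ibinom N (k - 1 - b * (m + n - k - l)) := by
    intro b
    rw [Odd.neg_one_pow (Int.natAbs_odd.2 ⟨b, by ring⟩), neg_one_mul]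
    congr 2
    ring
  have finite_support_sub : ∀ x : ℤ,
      (Function.support fun b : ℤ => ibinom N (x - b * (m + n - k - l))).Finite := by
    intro x
    convert (finite_support_ibinom hW N x).preimage neg_injective.injOn using 1
    ext b
    simp [sub_eq_add_neg]
  rw [hcount, ← hN, finsum_mem_Tset]
  · simp only [term₁, term₂]
    rw [finsum_neg_distrib, ← residueSum_eq_finsum_sub, ← residueSum_eq_finsum_sub,
      ← residueSum_symm _ N (k - 1),
      show (N : ℤ) - (k - 1) = l - 1 + (m + n - k - l) by omega, residueSum_add_self]
    ring
  · simp only [term₁]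
    exact finite_support_sub _
  · simp only [term₂, Function.support_fun_neg]
    exact finite_support_sub _
end

section
/- Let m, n, k be non-negative integers with k ≤ min(m−2, n−2), and let Y = {(i,j) ∈ ℤ×ℤ : 1 ≤ i ≤ m, 1 ≤ j ≤ min(n, n+m−k−i)} be the one-sided diagonal ladder. Let P = (1, n) and Q = (m, 1). Then the number of paths in Y from P to Q equals C(m+n−2, m−1) − C(m+n−2, k−1). -/
theorem ibinom_of_neg_left {N : ℤ} (hN : N < 0) (x : ℤ) : ibinom N x = 0 :=
  if_neg fun h => absurd h.1 (by omega)

theorem ibinom_of_neg_right (N : ℤ) {x : ℤ} (hx : x < 0) : ibinom N x = 0 :=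
  if_neg fun h => absurd h.2 (by omega)

theorem ibinom_of_lt {N x : ℤ} (h : N < x) : ibinom N x = 0 := by
  unfold ibinom
  split_ifs with h'
  · rw [Nat.choose_eq_zero_of_lt (by omega), Nat.cast_zero]
  · rfl

theorem ibinom_zero_zero : ibinom 0 0 = 1 := by
  simp [ibinom]

theorem pathCount_eq_ncard (Y : Set (ℤ × ℤ)) (P Q : ℤ × ℤ) :
    pathCount Y P Q = {c | LPath Y P Q c}.ncard :=
  rfl

theorem lPath_def {Y : Set (ℤ × ℤ)} {P Q : ℤ × ℤ} {c : List (ℤ × ℤ)} :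
    LPath Y P Q c ↔ c.head? = some P ∧ c.getLast? = some Q ∧ (∀ p ∈ c, p ∈ Y) ∧
      c.IsChain (fun p q : ℤ × ℤ => q = (p.1 + 1, p.2) ∨ q = (p.1, p.2 - 1)) :=
  Iff.rfl

theorem setOf_lPath_of_notMem {Y : Set (ℤ × ℤ)} {P : ℤ × ℤ} (hP : P ∉ Y) (Q : ℤ × ℤ) :
    {c | LPath Y P Q c} = ∅ := by
  ext c
  simp only [Set.mem_ofPred_eq, Set.mem_empty_iff_false, iff_false]
  rintro ⟨h, -, hY, -⟩
  exact hP (hY P (List.mem_of_mem_head? h))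

/-- A path is either a single point, or a first point followed by a path from one of its two
successors. -/
theorem lPath_iff_s7 {Y : Set (ℤ × ℤ)} {P : ℤ × ℤ} (hP : P ∈ Y) (Q : ℤ × ℤ) (c : List (ℤ × ℤ)) :
    LPath Y P Q c ↔ (P = Q ∧ c = [P]) ∨
      ∃ t, (LPath Y (P.1 + 1, P.2) Q t ∨ LPath Y (P.1, P.2 - 1) Q t) ∧ P :: t = c := by
  match c with
  | [] => simp [lPath_def]
  | [a] =>
    simp only [lPath_def]
    constructor
    · rintro ⟨h, h', -⟩
      simp at h h'
      subst h h'
      simp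
    · rintro (⟨rfl, h⟩ | ⟨t, ht, h⟩)
      · simp at h
        subst h
        simp [hP]
      · simp at h
        simp [h.2] at ht
  | a :: b :: t =>
    simp only [lPath_def, List.head?_cons, List.getLast?_cons_cons, List.forall_mem_cons,
      List.isChain_cons_cons]
    grind

theorem disjoint_setOf_lPath (Y : Set (ℤ × ℤ)) {P P' : ℤ × ℤ} (h : P ≠ P') (Q : ℤ × ℤ) :
    Disjoint {c | LPath Y P Q c} {c | LPath Y P' Q c} :=
  Set.disjoint_left.2 fun _ hc hc' => h (Option.some.inj (hc.1.symm.trans hc'.1))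

theorem setOf_lPath_of_ne {Y : Set (ℤ × ℤ)} {P Q : ℤ × ℤ} (hP : P ∈ Y) (hPQ : P ≠ Q) :
    {c | LPath Y P Q c} = List.cons P ''
      ({c | LPath Y (P.1 + 1, P.2) Q c} ∪ {c | LPath Y (P.1, P.2 - 1) Q c}) := by
  ext c
  simp [lPath_iff_s7 hP, hPQ]

theorem pathCount_of_ne {Y : Set (ℤ × ℤ)} {P Q : ℤ × ℤ} (hP : P ∈ Y) (hPQ : P ≠ Q)
    (hr : {c | LPath Y (P.1 + 1, P.2) Q c}.Finite) (hd : {c | LPath Y (P.1, P.2 - 1) Q c}.Finite) :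
    pathCount Y P Q = pathCount Y (P.1 + 1, P.2) Q + pathCount Y (P.1, P.2 - 1) Q := by
  simp only [pathCount_eq_ncard]
  rw [setOf_lPath_of_ne hP hPQ, Set.ncard_image_of_injective _ List.cons_injective,
    Set.ncard_union_eq (disjoint_setOf_lPath Y (by simp) Q) hr hd]

theorem setOf_lPath_self {Y : Set (ℤ × ℤ)} {P : ℤ × ℤ} (hP : P ∈ Y)
    (hr : (P.1 + 1, P.2) ∉ Y) (hd : (P.1, P.2 - 1) ∉ Y) :
    {c | LPath Y P P c} = {[P]} := by
  have hr' := Set.eq_empty_iff_forall_notMem.1 (setOf_lPath_of_notMem hr P)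
  have hd' := Set.eq_empty_iff_forall_notMem.1 (setOf_lPath_of_notMem hd P)
  simp only [Set.mem_ofPred_eq] at hr' hd'
  ext c
  simp [lPath_iff_s7 hP, hr', hd']

/-- The number of paths in the one-sided ladder from an arbitrary starting point, given by the
reflection principle; the starting point may also lie just outside the ladder. -/
theorem pathCount_ladder {m n k : ℤ} (hkm : k ≤ m - 2) (hkn : k ≤ n - 2)
    {Y : Set (ℤ × ℤ)}
    (hY : ∀ i j : ℤ, (i, j) ∈ Y ↔ 1 ≤ i ∧ i ≤ m ∧ 1 ≤ j ∧ j ≤ n ∧ j ≤ n + m - k - i)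
    (s : ℕ) (i j : ℤ) (hi : 1 ≤ i) (him : i ≤ m + 1) (hj : 0 ≤ j) (hjn : j ≤ n)
    (hij : i + j ≤ n + m - k + 1) (hs : m - i + j < s) :
    {c | LPath Y (i, j) (m, 1) c}.Finite ∧ (pathCount Y (i, j) (m, 1) : ℤ) =
      ibinom (m - i + j - 1) (m - i) - ibinom (m - i + j - 1) (j - n + k - 1) := by
  induction s generalizing i j with
  | zero =>
    obtain ⟨rfl, rfl⟩ : i = m + 1 ∧ j = 0 := by omega
    have hout : ((m + 1, 0) : ℤ × ℤ) ∉ Y := by rw [hY]; omega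
    rw [pathCount_eq_ncard, setOf_lPath_of_notMem hout, ibinom_of_neg_left (by omega),
      ibinom_of_neg_left (by omega)]
    simp
  | succ s ih =>
    by_cases hmem : (i, j) ∈ Y
    · have hb := (hY i j).1 hmem
      by_cases hQ : i = m ∧ j = 1
      · obtain ⟨rfl, rfl⟩ := hQ
        have hset := setOf_lPath_self hmem (by rw [hY]; omega) (by rw [hY]; omega)
        rw [pathCount_eq_ncard, hset, ibinom_of_neg_right _ (show 1 - n + k - 1 < 0 by omega)]
        simp [ibinom_zero_zero]
      · have hne : ((i, j) : ℤ × ℤ) ≠ (m, 1) := by simpa using hQ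
        obtain ⟨fr, cr⟩ := ih (i + 1) j (by omega) (by omega) (by omega) (by omega) (by omega)
          (by push_cast at hs; omega)
        obtain ⟨fd, cd⟩ := ih i (j - 1) (by omega) (by omega) (by omega) (by omega) (by omega)
          (by push_cast at hs; omega)
        refine ⟨?_, ?_⟩
        · rw [setOf_lPath_of_ne hmem hne]
          exact (fr.union fd).image _
        · rw [pathCount_of_ne hmem hne fr fd, Nat.cast_add, cr, cd,
            ibinom_pascal (N := m - i + j - 1) (by omega) (m - i),
            ibinom_pascal (N := m - i + j - 1) (by omega) (j - n + k - 1)]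
          ring_nf
    · rw [pathCount_eq_ncard, setOf_lPath_of_notMem hmem]
      rw [hY] at hmem
      refine ⟨Set.finite_empty, ?_⟩
      rw [Set.ncard_empty, Nat.cast_zero, eq_comm, sub_eq_zero]
      by_cases hline : i + j = n + m - k + 1
      · rw [show m - i = j - n + k - 1 by omega]
      · rw [ibinom_of_neg_right _ (show j - n + k - 1 < 0 by omega)]
        by_cases hi' : i = m + 1
        · exact ibinom_of_neg_right _ (by omega)
        · exact ibinom_of_lt (by omega)

theorem stmt7 (m n k : ℤ) (hk0 : 0 ≤ k) (hk : k ≤ min (m - 2) (n - 2))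
    (Y : Set (ℤ × ℤ))
    (hY : Y = {p : ℤ × ℤ | 1 ≤ p.1 ∧ p.1 ≤ m ∧
      1 ≤ p.2 ∧ p.2 ≤ min n (n + m - k - p.1)}) :
    (pathCount Y (1, n) (m, 1) : ℤ) =
      ibinom (m + n - 2) (m - 1) - ibinom (m + n - 2) (k - 1) := by
  have hkm : k ≤ m - 2 := hk.trans (min_le_left _ _)
  have hkn : k ≤ n - 2 := hk.trans (min_le_right _ _)
  have h := (pathCount_ladder (Y := Y) hkm hkn (fun i j => by simp [hY])
    (m + n).toNat 1 n le_rfl (by omega) (by omega) le_rfl (by omega) (by omega)).2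
  rw [h]
  ring_nf
end

section
/- Let m be a positive integer. Then Σ_{(i,j)∈T} (−1)^{i+j} C(2m, m−2i−2j) = 2^m. -/
theorem bijOn_add_Tset : Set.BijOn (fun p : ℤ × ℤ => p.1 + p.2) Tset Set.univ := by
  refine ⟨fun _ _ => Set.mem_univ _, ?_, ?_⟩
  · rintro ⟨a, b⟩ h ⟨c, d⟩ h' heq
    simp only [Tset, Set.mem_ofPred_eq] at h h' heq
    ext <;> dsimp only <;> omega
  · intro s _
    refine ⟨((s + 1) / 2, s / 2), ?_, ?_⟩
    · simp only [Tset, Set.mem_ofPred_eq]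
      omega
    · dsimp only
      omega

theorem neg_one_zpow_eq_pow_natAbs {K : Type*} [DivisionRing K] (s : ℤ) :
    (-1 : K) ^ s = (-1) ^ s.natAbs := by
  obtain ⟨n, rfl | rfl⟩ := s.eq_nat_or_neg
  · simp
  · rw [zpow_neg, zpow_natCast, ← inv_pow, inv_neg_one, Int.natAbs_neg, Int.natAbs_natCast]

theorem Complex.I_zpow_two_mul (s : ℤ) : Complex.I ^ (2 * s) = (-1) ^ s.natAbs := by
  rw [zpow_mul, ← neg_one_zpow_eq_pow_natAbs]
  congr 1
  exact_mod_cast Complex.I_sq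

theorem Complex.re_neg_one_pow (n : ℕ) : ((-1 : ℂ) ^ n).re = (-1) ^ n := by
  have h : ((-1 : ℂ) ^ n) = (((-1 : ℝ) ^ n : ℝ) : ℂ) := by push_cast; rfl
  rw [h, Complex.ofReal_re]

theorem Complex.re_I_zpow_of_odd {n : ℤ} (hn : Odd n) : (Complex.I ^ n).re = 0 := by
  obtain ⟨s, rfl⟩ := hn
  rw [zpow_add₀ Complex.I_ne_zero, Complex.I_zpow_two_mul]
  rcases neg_one_pow_eq_or ℂ s.natAbs with h | h <;> simp [h]

theorem sum_I_zpow_mul_choose (m : ℕ) :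
    ∑ k ∈ Finset.range (2 * m + 1), Complex.I ^ ((m : ℤ) - k) * ((2 * m).choose k : ℂ) =
      2 ^ m := by
  have hI : Complex.I⁻¹ ^ m * Complex.I ^ m = 1 := by
    rw [← mul_pow, inv_mul_cancel₀ Complex.I_ne_zero, one_pow]
  calc _ = Complex.I ^ m * ∑ k ∈ Finset.range (2 * m + 1),
        Complex.I⁻¹ ^ k * 1 ^ (2 * m - k) * ((2 * m).choose k : ℂ) := by
        rw [Finset.mul_sum]
        refine Finset.sum_congr rfl fun k _ => ?_
        rw [zpow_sub₀ Complex.I_ne_zero, zpow_natCast, zpow_natCast, one_pow, inv_pow]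
        ring
    _ = Complex.I ^ m * ((Complex.I⁻¹ + 1) ^ 2) ^ m := by rw [← add_pow, pow_mul]
    _ = 2 ^ m := by
        rw [← mul_pow]
        congr 1
        rw [Complex.inv_I]
        linear_combination (Complex.I - 2) * Complex.I_sq

theorem stmt11 (m : ℕ) (hm : 0 < m) :
    ∑ᶠ p ∈ Tset, (-1 : ℤ) ^ (p.1 + p.2).natAbs *
      ibinom (2 * m) ((m : ℤ) - 2 * p.1 - 2 * p.2) = 2 ^ m := by
  rw [finsum_mem_eq_of_bijOn (g := fun s : ℤ => (-1 : ℤ) ^ s.natAbs * ibinom (2 * m) (m - 2 * s))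
    _ bijOn_add_Tset (fun p _ => by congr 2; ring), finsum_mem_univ,
    finsum_eq_sum_of_support_subset (s := Finset.Icc (-(m / 2 : ℤ)) (m / 2))]
  · have key := congrArg Complex.re (sum_I_zpow_mul_choose m)
    rw [Complex.re_sum, show ((2 : ℂ) ^ m).re = 2 ^ m by
      rw [← Complex.ofReal_ofNat, ← Complex.ofReal_pow, Complex.ofReal_re]] at key
    have : ((∑ s ∈ Finset.Icc (-(m / 2 : ℤ)) (m / 2),
        (-1 : ℤ) ^ s.natAbs * ibinom (2 * m) (m - 2 * s) : ℤ) : ℝ) = 2 ^ m := by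
      rw [← key]
      push_cast
      refine Finset.sum_of_injOn (fun s : ℤ => ((m : ℤ) - 2 * s).toNat) ?_ ?_ ?_ ?_
      · intro a ha b hb h
        simp only [Finset.coe_Icc, Set.mem_Icc] at ha hb h
        omega
      · intro a ha
        simp only [Finset.coe_Icc, Set.mem_Icc, Finset.coe_range, Set.mem_Iio] at ha ⊢
        omega
      · intro k hk hk'
        have hodd : Odd ((m : ℤ) - k) := by
          rw [← Int.not_even_iff_odd]
          rintro ⟨s, hs⟩
          refine hk' ⟨s, ?_, ?_⟩
          · simp only [Finset.coe_Icc, Set.mem_Icc, Finset.mem_range] at hk ⊢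
            omega
          · dsimp only
            omega
        rw [← Complex.ofReal_natCast, Complex.re_mul_ofReal, Complex.re_I_zpow_of_odd hodd,
          zero_mul]
      · intro s hs
        rw [Finset.mem_Icc] at hs
        rw [← Complex.ofReal_natCast, Complex.re_mul_ofReal,
          show (m : ℤ) - ((m : ℤ) - 2 * s).toNat = 2 * s by omega, Complex.I_zpow_two_mul,
          Complex.re_neg_one_pow, ibinom, if_pos (by omega),
          show (2 * (m : ℤ)).toNat = 2 * m by omega, Int.cast_natCast]
    exact_mod_cast this
  · intro s hs
    rw [Finset.coe_Icc, Set.mem_Icc]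
    by_contra h
    refine hs ?_
    dsimp only
    rw [ibinom]
    split_ifs
    · rw [Nat.choose_eq_zero_of_lt (by omega), Nat.cast_zero, mul_zero]
    · rw [mul_zero]
end

section
/- Let m be a positive integer and let F_i denote the i-th Fibonacci number (F_1 = F_2 = 1, F_{i+2} = F_{i+1} + F_i). Then F_{2m+1} = Σ_{(i,j)∈T} (−1)^{i+j} C(2m, m−3i−2j). -/
/-- The sum of `C(2m, k)` over the `k` with `k - m ≡ r` modulo `5`. -/
def centralResidueSum (m : ℕ) (r : ZMod 5) : ℤ :=
  ∑ k ∈ Finset.range (2 * m + 1), ((2 * m).choose k : ℤ) * if (k : ZMod 5) - m = r then 1 else 0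

theorem sum_choose_succ_mul_eq_add (N : ℕ) (w : ℕ → ℤ) :
    ∑ k ∈ Finset.range (N + 2), ((N + 1).choose k : ℤ) * w k =
      ∑ k ∈ Finset.range (N + 1), (N.choose k : ℤ) * w k +
        ∑ k ∈ Finset.range (N + 1), (N.choose k : ℤ) * w (k + 1) := by
  rw [Finset.sum_choose_succ_mul (fun i _ => w i) N, add_comm]

theorem centralResidueSum_succ (m : ℕ) (r : ZMod 5) :
    centralResidueSum (m + 1) r =
      centralResidueSum m (r + 1) + 2 * centralResidueSum m r + centralResidueSum m (r - 1) := by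
  unfold centralResidueSum
  rw [show 2 * (m + 1) = 2 * m + 1 + 1 by ring,
    sum_choose_succ_mul_eq_add (2 * m + 1) fun k =>
      if (k : ZMod 5) - ((m + 1 : ℕ) : ZMod 5) = r then 1 else 0,
    sum_choose_succ_mul_eq_add (2 * m), sum_choose_succ_mul_eq_add (2 * m) fun k =>
      if ((k + 1 : ℕ) : ZMod 5) - ((m + 1 : ℕ) : ZMod 5) = r then 1 else 0]
  have h₀ (k : ℕ) : (k : ZMod 5) - ((m + 1 : ℕ) : ZMod 5) = r ↔ (k : ZMod 5) - m = r + 1 := by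
    push_cast
    constructor <;> intro h <;> linear_combination h
  have h₁ (k : ℕ) :
      ((k + 1 : ℕ) : ZMod 5) - ((m + 1 : ℕ) : ZMod 5) = r ↔ (k : ZMod 5) - m = r := by
    push_cast
    constructor <;> intro h <;> linear_combination h
  have h₂ (k : ℕ) :
      ((k + 1 + 1 : ℕ) : ZMod 5) - ((m + 1 : ℕ) : ZMod 5) = r ↔ (k : ZMod 5) - m = r - 1 := by
    push_cast
    constructor <;> intro h <;> linear_combination h
  simp only [h₂]
  simp only [h₁]
  simp only [h₀]
  ring

theorem centralResidueSum_fib (m : ℕ) :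
    centralResidueSum m 0 - centralResidueSum m 2 = Nat.fib (2 * m + 1) ∧
      centralResidueSum m 1 - centralResidueSum m 2 = Nat.fib (2 * m) ∧
      centralResidueSum m 1 = centralResidueSum m 4 ∧
      centralResidueSum m 2 = centralResidueSum m 3 := by
  induction m with
  | zero => decide
  | succ m ih =>
    obtain ⟨h₀, h₁, h₂, h₃⟩ := ih
    have f₂ : (Nat.fib (2 * m + 2) : ℤ) = Nat.fib (2 * m) + Nat.fib (2 * m + 1) := by
      exact_mod_cast Nat.fib_add_two
    have f₃ : (Nat.fib (2 * m + 3) : ℤ) = Nat.fib (2 * m + 1) + Nat.fib (2 * m + 2) := by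
      exact_mod_cast Nat.fib_add_two
    have e₀ := centralResidueSum_succ m 0
    have e₁ := centralResidueSum_succ m 1
    have e₂ := centralResidueSum_succ m 2
    have e₃ := centralResidueSum_succ m 3
    have e₄ := centralResidueSum_succ m 4
    rw [show (0 : ZMod 5) + 1 = 1 by decide, show (0 : ZMod 5) - 1 = 4 by decide] at e₀
    rw [show (1 : ZMod 5) + 1 = 2 by decide, show (1 : ZMod 5) - 1 = 0 by decide] at e₁
    rw [show (2 : ZMod 5) + 1 = 3 by decide, show (2 : ZMod 5) - 1 = 1 by decide] at e₂
    rw [show (3 : ZMod 5) + 1 = 4 by decide, show (3 : ZMod 5) - 1 = 2 by decide] at e₃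
    rw [show (4 : ZMod 5) + 1 = 0 by decide, show (4 : ZMod 5) - 1 = 3 by decide] at e₄
    rw [show 2 * (m + 1) + 1 = 2 * m + 3 by ring, show 2 * (m + 1) = 2 * m + 2 by ring]
    refine ⟨?_, ?_, ?_, ?_⟩ <;> linarith

theorem ibinom_two_mul_natCast (m k : ℕ) : ibinom (2 * m) k = (2 * m).choose k := by
  rw [ibinom, if_pos (by omega), Int.toNat_natCast, show (2 * (m : ℤ)).toNat = 2 * m by omega]

theorem exists_natCast_of_ibinom_ne_zero {m : ℕ} {x : ℤ} (h : ibinom (2 * m) x ≠ 0) :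
    ∃ k : ℕ, k < 2 * m + 1 ∧ (k : ℤ) = x := by
  have hx : 0 ≤ x := by
    by_contra hx
    exact h (if_neg fun h => hx h.2)
  lift x to ℕ using hx
  refine ⟨x, ?_, rfl⟩
  by_contra hk
  exact h (by rw [ibinom_two_mul_natCast, Nat.choose_eq_zero_of_lt (by omega), Nat.cast_zero])

theorem zmod_five_sub_eq_iff (x m r : ℤ) :
    (x : ZMod 5) - (m : ZMod 5) = (r : ZMod 5) ↔ (5 : ℤ) ∣ x - m - r := by
  rw [← sub_eq_zero]
  exact_mod_cast ZMod.intCast_zmod_eq_zero_iff_dvd (x - m - r) 5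

/-- On `Tset` the map `(i, j) ↦ m - 3i - 2j` is a bijection onto the integers congruent to
`m` or `m + 2` modulo `5`, and it turns the sign into the difference of the two indicators. -/
theorem finsum_mem_Tset_eq (m : ℕ) :
    ∑ᶠ p ∈ Tset, (-1 : ℤ) ^ (p.1 + p.2).natAbs * ibinom (2 * m) ((m : ℤ) - 3 * p.1 - 2 * p.2) =
      ∑ᶠ x ∈ {x : ℤ | (5 : ℤ) ∣ x - m - 0 ∨ (5 : ℤ) ∣ x - m - 2},
        ibinom (2 * m) x *
          ((if (5 : ℤ) ∣ x - m - 0 then 1 else 0) - if (5 : ℤ) ∣ x - m - 2 then 1 else 0) := by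
  refine finsum_mem_eq_of_bijOn (fun p : ℤ × ℤ => (m : ℤ) - 3 * p.1 - 2 * p.2) ⟨?_, ?_, ?_⟩ ?_
  · rintro ⟨i, j⟩ h
    simp only [Tset, Set.mem_ofPred_eq] at h ⊢
    omega
  · rintro ⟨i, j⟩ h ⟨i', j'⟩ h' heq
    simp only [Tset, Set.mem_ofPred_eq] at h h' heq
    ext <;> simp only <;> omega
  · rintro x (⟨c, hc⟩ | ⟨c, hc⟩)
    · exact ⟨(-c, -c), by simp [Tset], by simp only; omega⟩
    · exact ⟨(-c, -c - 1), by simp [Tset], by simp only; omega⟩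
  · rintro ⟨i, j⟩ h
    simp only [Tset, Set.mem_ofPred_eq] at h ⊢
    rcases h with h | h
    · rw [if_pos (by omega), if_neg (by omega),
        Even.neg_one_pow (Int.natAbs_even.mpr ⟨i, by omega⟩)]
      ring
    · rw [if_neg (by omega), if_pos (by omega),
        Odd.neg_one_pow (Int.natAbs_odd.mpr ⟨j, by omega⟩)]
      ring

theorem finsum_mem_Tset_eq_centralResidueSum (m : ℕ) :
    ∑ᶠ p ∈ Tset, (-1 : ℤ) ^ (p.1 + p.2).natAbs * ibinom (2 * m) ((m : ℤ) - 3 * p.1 - 2 * p.2) =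
      centralResidueSum m 0 - centralResidueSum m 2 := by
  rw [finsum_mem_Tset_eq, finsum_mem_eq_sum_of_inter_support_eq
    (t := (Finset.range (2 * m + 1)).map Nat.castEmbedding)]
  · rw [Finset.sum_map, centralResidueSum, centralResidueSum, ← Finset.sum_sub_distrib]
    refine Finset.sum_congr rfl fun k _ => ?_
    have h₀ := zmod_five_sub_eq_iff k m 0
    have h₂ := zmod_five_sub_eq_iff k m 2
    push_cast at h₀ h₂
    simp only [Nat.castEmbedding_apply, ibinom_two_mul_natCast, h₀, h₂]
    ring
  · ext x
    simp only [Set.mem_inter_iff, Set.mem_ofPred_eq, Function.mem_support, Finset.coe_map,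
      Finset.coe_range, Set.mem_image, Set.mem_Iio, Nat.castEmbedding_apply]
    refine and_congr_left fun hx => ⟨fun _ => ?_, fun _ => ?_⟩
    · exact exists_natCast_of_ibinom_ne_zero (left_ne_zero_of_mul hx)
    · by_contra! h
      exact hx (by rw [if_neg h.1, if_neg h.2, sub_zero, mul_zero])

theorem stmt12 (m : ℕ) (hm : 0 < m) :
    (Nat.fib (2 * m + 1) : ℤ) =
      ∑ᶠ p ∈ Tset, (-1 : ℤ) ^ (p.1 + p.2).natAbs *
        ibinom (2 * m) ((m : ℤ) - 3 * p.1 - 2 * p.2) := by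
  rw [finsum_mem_Tset_eq_centralResidueSum, (centralResidueSum_fib m).1]
end
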